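/- Let K=K(c) be an A_n-crystal and let c',c'' in Z^n satisfy 0<=c'<=c''<=c. Let K(c':c'') denote the subgraph of K formed by all vertices and edges lying on directed paths from v[c'] to v[c'']. Then K(c':c'') is isomorphic, as an n-colored graph, to the A_n-crystal K(c''-c'), and this isomorphism maps the principal lattice of K(c''-c') onto the set {v[a] : c'<=a<=c''} of principal vertices of K. -/

import Mathlib

open Classical

noncomputable section

/-- Iterate a partial operator `k` times. -/
def optIter {V : Type} (f : V → Option V) : ℕ → V → Option V
  | 0, v => some v
  | k + 1, v => (f v).bind (optIter f k)

/-- A vertex type together with, for every natural number (color) `i`,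
a partial operator whose graph is the set of `i`-edges. -/
structure PreGraph where
  V : Type
  F : ℕ → V → Option V

namespace PreGraph

/-- Partial inverse operator of color `i`. -/
def Finv (K : PreGraph) (i : ℕ) (v : K.V) : Option K.V :=
  if h : ∃ u, K.F i u = some v then some h.choose else none

/-- Number of edges of the maximal `i`-colored path beginning at `v`. -/
def h (K : PreGraph) (i : ℕ) (v : K.V) : ℕ :=
  sSup {k | (optIter (K.F i) k v).isSome = true}

/-- Number of edges of the maximal `i`-colored path ending at `v`. -/
def t (K : PreGraph) (i : ℕ) (v : K.V) : ℕ :=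
  sSup {k | ∃ u, optIter (K.F i) k u = some v}

/-- One (undirected) step along an edge of any color. -/
def Step (K : PreGraph) (u v : K.V) : Prop :=
  ∃ i, K.F i u = some v ∨ K.F i v = some u

/-- Weak connectivity. -/
def Connected (K : PreGraph) : Prop :=
  ∀ u v : K.V, Relation.ReflTransGen K.Step u v

/-- All edges have colors in `C`. -/
def ColorsIn (K : PreGraph) (C : Set ℕ) : Prop :=
  ∀ i ∉ C, ∀ v, K.F i v = none

end PreGraph

/-- `s` has no incoming edges. -/
def IsSource (K : PreGraph) (s : K.V) : Prop := ∀ i u, K.F i u ≠ some s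

/-- `tv` has no outgoing edges. -/
def IsSink (K : PreGraph) (tv : K.V) : Prop := ∀ i, K.F i tv = none

/-- `K` is a (finite) colored graph with colors in `C` satisfying axiom (A1):
every connected monochromatic subgraph is a finite directed path. -/
def IsColored (K : PreGraph) (C : Set ℕ) : Prop :=
  Finite K.V ∧ K.ColorsIn C ∧
  (∀ (i : ℕ) (u u' v : K.V), K.F i u = some v → K.F i u' = some v → u = u') ∧
  (∀ (i : ℕ) (v : K.V) (k : ℕ), 0 < k → optIter (K.F i) k v ≠ some v)

/-- `|i - j| = 1`. -/
def Neighb (i j : ℕ) : Prop := i + 1 = j ∨ j + 1 = i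

/-- `|i - j| ≥ 2`. -/
def Far (i j : ℕ) : Prop := i + 2 ≤ j ∨ j + 2 ≤ i

instance (i j : ℕ) : Decidable (Neighb i j) := by unfold Neighb; infer_instance
instance (i j : ℕ) : Decidable (Far i j) := by unfold Far; infer_instance

/-- Axiom (A2) for the ordered pair of distinct colors `(i, j)`. -/
def A2at (K : PreGraph) (i j : ℕ) : Prop :=
  (∀ u v, K.F i u = some v →
    K.t j v ≤ K.t j u ∧ K.h j u ≤ K.h j v ∧
    ((K.h j u : ℤ) - (K.t j u : ℤ)) - ((K.h j v : ℤ) - (K.t j v : ℤ)) =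
      (if Neighb i j then (-1 : ℤ) else 0)) ∧
  (∀ u v w, K.F i u = some v → K.F i v = some w →
    2 * K.h j v ≤ K.h j u + K.h j w)

/-- Axiom (A3) for neighboring colors `i, j`. -/
def A3at (K : PreGraph) (i j : ℕ) : Prop :=
  (∀ u v v', K.F i u = some v → K.F j u = some v' →
    K.h j v = K.h j u →
    ((K.h i v' : ℤ) - (K.h i u : ℤ) = 1 ∧ ∃ w, K.F j v = some w ∧ K.F i v' = some w)) ∧
  (∀ u u' v, K.F i u = some v → K.F j u' = some v →
    (K.h j v : ℤ) - (K.h j u : ℤ) = 1 →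
    (K.h i v = K.h i u' ∧ ∃ w, K.F j w = some u ∧ K.F i w = some u'))

/-- Axiom (A4) (Verma relations) for neighboring colors `i, j`. -/
def A4at (K : PreGraph) (i j : ℕ) : Prop :=
  (∀ u v v', K.F i u = some v → K.F j u = some v' →
    (K.h j v : ℤ) - (K.h j u : ℤ) = 1 → (K.h i v' : ℤ) - (K.h i u : ℤ) = 1 →
    ∃ w, (((K.F i u).bind (K.F j)).bind (K.F j)).bind (K.F i) = some w ∧
         (((K.F j u).bind (K.F i)).bind (K.F i)).bind (K.F j) = some w) ∧
  (∀ u u' v, K.F i u = some v → K.F j u' = some v →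
    K.h j v = K.h j u → K.h i v = K.h i u' →
    ∃ w, (((K.Finv i v).bind (K.Finv j)).bind (K.Finv j)).bind (K.Finv i) = some w ∧
         (((K.Finv j v).bind (K.Finv i)).bind (K.Finv i)).bind (K.Finv j) = some w)

/-- Axiom (A5) for colors `i, j` at distance at least 2. -/
def A5at (K : PreGraph) (i j : ℕ) : Prop :=
  ∀ Fi ∈ ({K.F i, K.Finv i} : Set (K.V → Option K.V)),
  ∀ Fj ∈ ({K.F j, K.Finv j} : Set (K.V → Option K.V)),
  ∀ v, (Fi v).isSome → (Fj v).isSome →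
    ∃ w, (Fi v).bind Fj = some w ∧ (Fj v).bind Fi = some w

/-- `K` is a regular crystal of type A on the color set `C`
(an `A_{|C|}`-crystal when `C` is an integer interval). -/
def IsCrystalOn (K : PreGraph) (C : Set ℕ) : Prop :=
  IsColored K C ∧ K.Connected ∧
  (∀ i ∈ C, ∀ j ∈ C, i ≠ j → A2at K i j) ∧
  (∀ i ∈ C, ∀ j ∈ C, Neighb i j → A3at K i j ∧ A4at K i j) ∧
  (∀ i ∈ C, ∀ j ∈ C, Far i j → A5at K i j)

/-- `K` is an `A_n`-crystal (colors `1, …, n`). -/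
def IsACrystal (n : ℕ) (K : PreGraph) : Prop := IsCrystalOn K (Set.Icc 1 n)

/-- Apply a list of operators, head first. -/
def applyStr (K : PreGraph) : List ℕ → K.V → Option K.V
  | [], v => some v
  | i :: L, v => (K.F i v).bind (applyStr K L)

/-- The string `w_{m,k,j} = F_{o+j} F_{o+j+1} ⋯ F_{o+j+k-1}` (rightmost applied
first, i.e. head of the list applied first) for a crystal with colors `o+1, …, o+m`. -/
def wStr (o k j : ℕ) : List ℕ := (List.range k).map (fun m => o + j + k - 1 - m)

/-- The string `S_{m,k} = w_{m,k,m-k+1} ⋯ w_{m,k,2} w_{m,k,1}` for a crystal with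
colors `o+1, …, o+m`. -/
def SStr (o m k : ℕ) : List ℕ :=
  (List.range (m - k + 1)).flatMap fun jm => wStr o k (jm + 1)

/-- The string `S_{m,m}^{a_{o+m}} ⋯ S_{m,1}^{a_{o+1}}` for a crystal with colors
`o+1, …, o+m`, defining the principal vertex with coordinates `a`. -/
def prinStr (o m : ℕ) (a : ℕ → ℕ) : List ℕ :=
  (List.range m).flatMap fun km => (List.replicate (a (o + km + 1)) (SStr o m (km + 1))).flatten

def prinOpt (K : PreGraph) (o m : ℕ) (s : K.V) (a : ℕ → ℕ) : Option K.V :=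
  applyStr K (prinStr o m a) s

/-- `p` is the principal vertex with coordinates `a` of the crystal `K` with colors
`o+1, …, o+m` and source `s`. -/
def IsPrin (K : PreGraph) (o m : ℕ) (s : K.V) (a : ℕ → ℕ) (p : K.V) : Prop :=
  prinOpt K o m s a = some p

/-- The principal lattice of an `A_n`-crystal with source `s` and parameter `c`. -/
def PrinLat (K : PreGraph) (n : ℕ) (s : K.V) (c : ℕ → ℕ) : Set K.V :=
  {p | ∃ a : ℕ → ℕ, (∀ i, 1 ≤ i → i ≤ n → a i ≤ c i) ∧ IsPrin K 0 n s a p}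

/-- One undirected step along an edge with color in `I`. -/
def stepOn (K : PreGraph) (I : Set ℕ) (u v : K.V) : Prop :=
  ∃ i ∈ I, K.F i u = some v ∨ K.F i v = some u

/-- `u` lies in the same `I`-colored component as `v`. -/
def inComp (K : PreGraph) (I : Set ℕ) (v u : K.V) : Prop :=
  Relation.ReflTransGen (stepOn K I) v u

/-- The subcrystal of `K` with color set `I` containing `v` (the maximal connected
subgraph through `v` using only colors in `I`). -/
def PreGraph.sub (K : PreGraph) (I : Set ℕ) (v : K.V) : PreGraph where
  V := {u : K.V // inComp K I v u}
  F := fun i u =>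
    if hi : i ∈ I then
      (K.F i u.1).pbind fun w hw =>
        some ⟨w, Relation.ReflTransGen.tail u.2 ⟨i, hi, Or.inl (Option.mem_def.mp hw)⟩⟩
    else none

/-- Directed reachability. -/
def dirReach (K : PreGraph) (u v : K.V) : Prop :=
  Relation.ReflTransGen (fun a b => ∃ i, K.F i a = some b) u v

/-- The interval of `K` from `p` to `q`: the subgraph formed by all vertices and
edges lying on directed paths from `p` to `q`. -/
def PreGraph.interval (K : PreGraph) (p q : K.V) : PreGraph where
  V := {w : K.V // dirReach K p w ∧ dirReach K w q}
  F := fun i u =>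
    (K.F i u.1).pbind fun w _ =>
      if hw : dirReach K p w ∧ dirReach K w q then some ⟨w, hw⟩ else none

/-- The symmetric extract: restriction to self-complementary vertices,
with `ibar`-edges given by `chain i`. -/
def extract (K : PreGraph) (chain : ℕ → K.V → Option K.V) (σ : K.V → K.V) : PreGraph where
  V := {v : K.V // σ v = v}
  F := fun i u =>
    (chain i u.1).pbind fun w _ => if hw : σ w = w then some ⟨w, hw⟩ else none

/-- The operator chain for the color `ibar` of the symmetric extract of a
symmetric `A_{2n-1}`-crystal. -/
def chainB (K : PreGraph) (n : ℕ) (i : ℕ) (u : K.V) : Option K.V :=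
  if 1 ≤ i ∧ i ≤ n then
    (if i = n then K.F n u else (K.F i u).bind (K.F (2 * n - i)))
  else none

/-- The operator chain for the color `ibar` of the symmetric extract of a
symmetric `A_{2n}`-crystal. -/
def chainC (K : PreGraph) (n : ℕ) (i : ℕ) (u : K.V) : Option K.V :=
  if 1 ≤ i ∧ i ≤ n then
    (if i = n then (((K.F n u).bind (K.F (n + 1))).bind (K.F (n + 1))).bind (K.F n)
     else (K.F i u).bind (K.F (2 * n + 1 - i)))
  else none

/-- Symmetric extract from a symmetric `A_{2n-1}`-crystal. -/
def extractB (K : PreGraph) (n : ℕ) (σ : K.V → K.V) : PreGraph := extract K (chainB K n) σ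

/-- Symmetric extract from a symmetric `A_{2n}`-crystal. -/
def extractC (K : PreGraph) (n : ℕ) (σ : K.V → K.V) : PreGraph := extract K (chainC K n) σ

/-- Admissibility of a six-tuple `(x', y, x''; y', x, y'')` in the worm model. -/
def WormOK (g1 g2 : ℕ) : ℤ × ℤ × ℤ × ℤ × ℤ × ℤ → Prop
  | (x', y, x'', y', x, y'') =>
    (0 ≤ x' ∧ x' ≤ 2 * (g1 : ℤ)) ∧ (0 ≤ x'' ∧ x'' ≤ 2 * (g1 : ℤ)) ∧
    (0 ≤ x ∧ x ≤ 2 * (g1 : ℤ)) ∧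
    (0 ≤ y' ∧ y' ≤ (g2 : ℤ)) ∧ (0 ≤ y'' ∧ y'' ≤ (g2 : ℤ)) ∧ (0 ≤ y ∧ y ≤ (g2 : ℤ)) ∧
    (2 ∣ x') ∧ (2 ∣ x'') ∧ (y' ≤ y ∧ y ≤ y'') ∧ (x' ≤ x ∧ x ≤ x'') ∧
    (y' < y → x' = x) ∧ (y < y'' → x = x'')

/-- The candidate image of a worm under the operator `1tilde`. -/
def worm1 : ℤ × ℤ × ℤ × ℤ × ℤ × ℤ → ℤ × ℤ × ℤ × ℤ × ℤ × ℤ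
  | (x', y, x'', y', x, y'') =>
    if 2 * x > x' + x'' then (x' + 2, y, x'', y', x, y'')
    else if x = x' ∧ x' = x'' ∧ y < y'' then (x', y + 1, x'', y', x, y'')
    else (x', y, x'' + 2, y', x, y'')

/-- The candidate image of a worm under the operator `2tilde`. -/
def worm2 : ℤ × ℤ × ℤ × ℤ × ℤ × ℤ → ℤ × ℤ × ℤ × ℤ × ℤ × ℤ
  | (x', y, x'', y', x, y'') =>
    if 2 * y > y' + y'' then (x', y, x'', y' + 1, x, y'')
    else if y' = y ∧ y = y'' ∧ x < x'' then (x', y, x'', y', x + 1, y'')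
    else (x', y, x'', y', x, y'' + 1)

/-- The worm graph `W(g1, g2)`, with colors `1 = 1tilde` and `2 = 2tilde`. -/
def WormGraph (g1 g2 : ℕ) : PreGraph where
  V := {w : ℤ × ℤ × ℤ × ℤ × ℤ × ℤ // WormOK g1 g2 w}
  F := fun i u =>
    if i = 1 then
      (if h1 : WormOK g1 g2 (worm1 u.1) then some ⟨worm1 u.1, h1⟩ else none)
    else if i = 2 then
      (if h2 : WormOK g1 g2 (worm2 u.1) then some ⟨worm2 u.1, h2⟩ else none)
    else none

/-- Isomorphism of colored graphs, renaming colors via `φ`. -/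
def IsoVia (K L : PreGraph) (φ : ℕ → ℕ) : Prop :=
  ∃ e : K.V ≃ L.V, ∀ i u v, K.F i u = some v ↔ L.F (φ i) (e u) = some (e v)

/-- The Cartesian product of an `i`-path of length `p` and a `j`-path of length `q`. -/
def boxGraph (i j p q : ℕ) : PreGraph where
  V := Fin (p + 1) × Fin (q + 1)
  F := fun s u =>
    if s = i then
      (if h : (u.1 : ℕ) < p then some (⟨(u.1 : ℕ) + 1, by omega⟩, u.2) else none)
    else if s = j then
      (if h : (u.2 : ℕ) < q then some (u.1, ⟨(u.2 : ℕ) + 1, by omega⟩) else none)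
    else none

/-- `B_n`-crystal: components with colors `n-1, n` are worm graphs,
with color `n-1` corresponding to `1tilde` and `n` to `2tilde`. -/
def IsBCrystal (n : ℕ) (B : PreGraph) : Prop :=
  IsColored B (Set.Icc 1 n) ∧ B.Connected ∧
  (∀ i ∈ Set.Icc 1 n, ∀ j ∈ Set.Icc 1 n, Far i j → A5at B i j) ∧
  (∀ i j, 1 ≤ i → i < n → 1 ≤ j → j < n → Neighb i j →
    ∀ v : B.V, IsCrystalOn (B.sub {i, j} v) {i, j}) ∧
  (∀ v : B.V, ∃ g1 g2 : ℕ,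
    IsoVia (B.sub ({n - 1, n} : Set ℕ) v) (WormGraph g1 g2)
      (fun x => if x = n - 1 then 1 else if x = n then 2 else 0))

/-- `C_n`-crystal: components with colors `n-1, n` are worm graphs,
with color `n-1` corresponding to `2tilde` and `n` to `1tilde`. -/
def IsCCrystal (n : ℕ) (B : PreGraph) : Prop :=
  IsColored B (Set.Icc 1 n) ∧ B.Connected ∧
  (∀ i ∈ Set.Icc 1 n, ∀ j ∈ Set.Icc 1 n, Far i j → A5at B i j) ∧
  (∀ i j, 1 ≤ i → i < n → 1 ≤ j → j < n → Neighb i j →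
    ∀ v : B.V, IsCrystalOn (B.sub {i, j} v) {i, j}) ∧
  (∀ v : B.V, ∃ g1 g2 : ℕ,
    IsoVia (B.sub ({n - 1, n} : Set ℕ) v) (WormGraph g1 g2)
      (fun x => if x = n - 1 then 2 else if x = n then 1 else 0))

/-! ### The crossing model -/

/-- `(k, i, j)` is a node `v_i^k(j)` of the supporting graph `G` for rank `n`. -/
def isNode (n k i j : ℕ) : Prop :=
  1 ≤ j ∧ j ≤ i ∧ i ≤ n ∧ i - j + 1 ≤ k ∧ k ≤ n - j + 1

instance (n k i j : ℕ) : Decidable (isNode n k i j) := by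
  unfold isNode; infer_instance

/-- Extension of a function on the nodes of `G` to the extended supporting graph:
extra nodes from which `G^k` is reachable get value `c k`, the others get `0`. -/
def fext (n : ℕ) (c : ℕ → ℕ) (f : ℕ × ℕ × ℕ → ℤ) (k i j : ℕ) : ℤ :=
  if isNode n k i j then f (k, i, j)
  else if j ≤ n - k + 1 then (c k : ℤ) else 0

/-- The slack at the node `v_i^k(j)`. -/
def epsN (n : ℕ) (c : ℕ → ℕ) (f : ℕ × ℕ × ℕ → ℤ) (k i j : ℕ) : ℤ :=
  (fext n c f k (i - 1) (j - 1) - fext n c f k i j) -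
    (fext n c f k i (j - 1) - fext n c f k (i + 1) j)

/-- The total slack at the multinode `V_i(j)`. -/
def epsTot (n : ℕ) (c : ℕ → ℕ) (f : ℕ × ℕ × ℕ → ℤ) (i j : ℕ) : ℤ :=
  ∑ k ∈ Finset.Icc (i - j + 1) (n - j + 1), epsN n c f k i j

/-- The reduced slack at the multinode `V_i(j)`. -/
def teps (n : ℕ) (c : ℕ → ℕ) (f : ℕ × ℕ × ℕ → ℤ) (i j : ℕ) : ℤ :=
  if hj : (Finset.Icc 1 j).Nonempty then
    max 0 ((Finset.Icc 1 j).inf' hj fun p => ∑ q ∈ Finset.Icc p j, epsTot n c f i q)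
  else 0

/-- `k0` satisfies the switch condition in the multinode `V_i(j)`. -/
def switchCond (n : ℕ) (f : ℕ × ℕ × ℕ → ℤ) (i j k0 : ℕ) : Prop :=
  i - j + 1 ≤ k0 ∧ k0 ≤ n - j + 1 ∧
  (∀ k, i - j + 1 ≤ k → k < k0 → isNode n k (i + 1) (j + 1) →
    f (k, i, j) = f (k, i + 1, j + 1)) ∧
  (∀ k, k0 < k → k ≤ n - j + 1 → isNode n k (i + 1) j →
    f (k, i + 1, j) = f (k, i, j))

/-- The switch-node (first node with the switch property) of the multinode `V_i(j)`. -/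
def switchNode (n : ℕ) (f : ℕ × ℕ × ℕ → ℤ) (i j : ℕ) : ℕ :=
  sInf {k0 | switchCond n f i j k0}

/-- Feasible functions of the crossing model (normalized to vanish off the nodes). -/
def Feasible (n : ℕ) (c : ℕ → ℕ) (f : ℕ × ℕ × ℕ → ℤ) : Prop :=
  (∀ k i j, ¬ isNode n k i j → f (k, i, j) = 0) ∧
  (∀ k i j, isNode n k i j → isNode n k (i - 1) j → f (k, i - 1, j) ≤ f (k, i, j)) ∧
  (∀ k i j, isNode n k i j → isNode n k (i + 1) (j + 1) → f (k, i + 1, j + 1) ≤ f (k, i, j)) ∧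
  (∀ k i j, isNode n k i j → 0 ≤ f (k, i, j) ∧ f (k, i, j) ≤ (c k : ℤ)) ∧
  (∀ i j, 1 ≤ j → j ≤ i → i ≤ n → ∃ k0, switchCond n f i j k0)

/-- Increase `f` by one at the node `(k, i, j)`. -/
def bump (f : ℕ × ℕ × ℕ → ℤ) (k i j : ℕ) : ℕ × ℕ × ℕ → ℤ :=
  fun x => if x = (k, i, j) then f x + 1 else f x

/-- The crossing-model graph `Kscr(c)`: vertices are the feasible functions, and
the move `φ_i` increases `f` by one at the switch-node of the active multinode. -/
def Kscr (n : ℕ) (c : ℕ → ℕ) : PreGraph where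
  V := {f : ℕ × ℕ × ℕ → ℤ // Feasible n c f}
  F := fun i f =>
    if 1 ≤ i ∧ i ≤ n ∧ ∃ j, 1 ≤ j ∧ j ≤ i ∧ 0 < teps n c f.1 i j then
      (let j := sSup {j | 1 ≤ j ∧ j ≤ i ∧ 0 < teps n c f.1 i j}
       let g := bump f.1 (switchNode n f.1 i j) i j
       if hg : Feasible n c g then some ⟨g, hg⟩ else none)
    else none

/-- The function `f_{a,D}` of the crossing model. -/
def faD (n : ℕ) (a : ℕ → ℕ) (D : ℕ → ℤ) : ℕ × ℕ × ℕ → ℤ := fun x =>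
  if isNode n x.1 x.2.1 x.2.2 then
    (if x.2.1 - x.2.2 + 1 = x.1 then (a x.1 : ℤ) else (a x.1 : ℤ) + min (D (x.1 - 1)) 0) +
    (if x.2.2 ≤ n - x.1 then max (D x.1) 0 else 0)
  else 0

/-! ### Descriptions of self-complementary vertices -/

/-- `(a1, a2, δ, l)` is the description of a self-complementary vertex `v` of a
symmetric `A_3`-crystal `K` with source `s` and parameter `c`. -/
def IsDescB (K : PreGraph) (s : K.V) (c : ℕ → ℕ) (v : K.V) (q : ℕ × ℕ × ℤ × ℕ) : Prop :=
  q.2.2.2 = K.t 2 v ∧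
  ∃ (a : ℕ → ℕ) (pa : K.V),
    a 1 = q.1 ∧ a 2 = q.2.1 ∧ a 3 = ((q.1 : ℤ) + max q.2.2.1 0).toNat ∧
    (∀ i, 1 ≤ i → i ≤ 3 → a i ≤ c i) ∧
    IsPrin K 0 3 s a pa ∧ inComp K (Set.Icc 1 2) pa v ∧
    0 ≤ (q.2.1 : ℤ) + q.2.2.1 ∧ 0 ≤ (a 3 : ℤ) - q.2.2.1 ∧
    ∃ s' : (K.sub (Set.Icc 1 2) pa).V, IsSource (K.sub (Set.Icc 1 2) pa) s' ∧
    ∃ z : (K.sub (Set.Icc 1 2) pa).V,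
      IsPrin (K.sub (Set.Icc 1 2) pa) 0 2 s'
        (fun i => if i = 1 then ((q.2.1 : ℤ) + q.2.2.1).toNat else ((a 3 : ℤ) - q.2.2.1).toNat) z ∧
      inComp K ({2} : Set ℕ) z.1 v

/-- The polytope of descriptions for a symmetric `A_3`-crystal with parameter `(c1, c2, c1)`. -/
def QuadB (c1 c2 : ℕ) : Set (ℕ × ℕ × ℤ × ℕ) :=
  {q | q.1 ≤ c1 ∧ q.2.1 ≤ c2 ∧ -(q.2.1 : ℤ) ≤ q.2.2.1 ∧ (q.2.1 : ℤ) - (c2 : ℤ) ≤ q.2.2.1 ∧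
       q.2.2.1 ≤ (c1 : ℤ) - (q.1 : ℤ) ∧ (q.2.2.2 : ℤ) ≤ (c2 : ℤ) + 2 * q.2.2.1}

/-- The worm associated to the description `(a1, a2, δ, l)`. -/
def wtupleB (a1 a2 : ℕ) (δ : ℤ) (l : ℕ) : ℤ × ℤ × ℤ × ℤ × ℤ × ℤ :=
  let a3 : ℤ := (a1 : ℤ) + max δ 0
  let tr : ℤ × ℤ × ℤ :=
    if 0 ≤ δ then
      if (l : ℤ) ≤ (a2 : ℤ) then ((l : ℤ), 2 * (a1 : ℤ), (a2 : ℤ))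
      else if (l : ℤ) ≤ (a2 : ℤ) + 2 * δ then
        ((a2 : ℤ), 2 * (a1 : ℤ) + (l : ℤ) - (a2 : ℤ), (a2 : ℤ))
      else ((a2 : ℤ), 2 * a3, (l : ℤ) - 2 * δ)
    else
      if (l : ℤ) ≤ (a2 : ℤ) + δ then ((l : ℤ), 2 * (a1 : ℤ), (a2 : ℤ) - δ)
      else ((a2 : ℤ) + δ, 2 * (a1 : ℤ), (l : ℤ) - 2 * δ)
  (2 * (a1 : ℤ), (a2 : ℤ), 2 * a3, tr.1, tr.2.1, tr.2.2)

def wtQ (q : ℕ × ℕ × ℤ × ℕ) : ℤ × ℤ × ℤ × ℤ × ℤ × ℤ :=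
  wtupleB q.1 q.2.1 q.2.2.1 q.2.2.2

/-- The string `(F_2 F_3)^r (F_3 F_2)^r` (rightmost applied first). -/
def diagStr (r : ℕ) : List ℕ :=
  (List.replicate r ([2, 3] : List ℕ)).flatten ++ (List.replicate r ([3, 2] : List ℕ)).flatten

/-- `(a1, a2, δ, ρ)` is the description of a self-complementary vertex `v` of a
symmetric `A_4`-crystal `K` with source `s` and parameter `c`. -/
def IsDescC (K : PreGraph) (s : K.V) (c : ℕ → ℕ) (v : K.V) (q : ℕ × ℕ × ℤ × ℕ) : Prop :=
  ∃ (a : ℕ → ℕ) (pa : K.V),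
    a 1 = q.1 ∧ a 2 = q.2.1 ∧ a 3 = ((q.2.1 : ℤ) + min q.2.2.1 0).toNat ∧
    a 4 = ((q.1 : ℤ) + max q.2.2.1 0).toNat ∧
    (∀ i, 1 ≤ i → i ≤ 4 → a i ≤ c i) ∧
    IsPrin K 0 4 s a pa ∧ inComp K (Set.Icc 1 3) pa v ∧
    0 ≤ (q.2.1 : ℤ) + q.2.2.1 ∧ 0 ≤ (a 4 : ℤ) - q.2.2.1 ∧
    (∃ s' : (K.sub (Set.Icc 1 3) pa).V, IsSource (K.sub (Set.Icc 1 3) pa) s' ∧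
     ∃ z : (K.sub (Set.Icc 1 3) pa).V,
       IsPrin (K.sub (Set.Icc 1 3) pa) 0 3 s'
         (fun i => if i = 1 then ((q.2.1 : ℤ) + q.2.2.1).toNat
                   else if i = 2 then a 3 else ((a 4 : ℤ) - q.2.2.1).toNat) z ∧
       inComp K (Set.Icc 2 3) z.1 v) ∧
    (∃ stil : (K.sub (Set.Icc 2 3) v).V, IsSource (K.sub (Set.Icc 2 3) v) stil ∧
       applyStr (K.sub (Set.Icc 2 3) v) (diagStr q.2.2.2) stil =
         some ⟨v, Relation.ReflTransGen.refl⟩)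

/-- The polytope of descriptions for a symmetric `A_4`-crystal with parameter
`(c1, c2, c2, c1)`. -/
def QuadC (c1 c2 : ℕ) : Set (ℕ × ℕ × ℤ × ℕ) :=
  {q | q.1 ≤ c1 ∧ q.2.1 ≤ c2 ∧ -(q.2.1 : ℤ) ≤ q.2.2.1 ∧
       q.2.2.1 ≤ (c1 : ℤ) - (q.1 : ℤ) ∧ (q.2.2.2 : ℤ) ≤ (c2 : ℤ) + q.2.2.1}

end

/-! ### Crystals as edge relations -/

/-- The axioms of an `A_n`-crystal that concern outgoing edges, for an edge relation `E` with
string lengths `h` and `t`; connectedness is not required. -/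
structure HalfCrystal (n : ℕ) {V : Type} (E : ℕ → V → V → Prop) (h t : ℕ → V → ℕ) : Prop where
  color : ∀ {i u v}, E i u v → 1 ≤ i ∧ i ≤ n
  det : ∀ {i u v w}, E i u v → E i u w → v = w
  pos_iff : ∀ {i u}, 0 < h i u ↔ ∃ v, E i u v
  step : ∀ {i u v}, E i u v → h i u = h i v + 1
  bdd : ∀ i, ∃ B, ∀ v, h i v ≤ B
  far : ∀ {i j u v}, Far i j → E i u v → h j v = h j u
  near : ∀ {i j u v}, Neighb i j → 1 ≤ j → j ≤ n → E i u v →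
    (h j v = h j u + 1 ∧ t j v = t j u) ∨ (h j v = h j u ∧ t j u = t j v + 1)
  convex : ∀ {i j u v w}, Neighb i j → 1 ≤ j → j ≤ n → E i u v → E i v w →
    h j v = h j u + 1 → h j w = h j v + 1
  square : ∀ {i j u v w}, Neighb i j → E i u v → E j u w → h j v = h j u →
    h i w = h i u + 1 ∧ ∃ x, E j v x ∧ E i w x
  verma : ∀ {i j u v w}, Neighb i j → E i u v → E j u w → h j v = h j u + 1 → h i w = h i u + 1 →
    ∃ v₂ v₃ w₂ w₃ x, E j v v₂ ∧ E j v₂ v₃ ∧ E i v₃ x ∧ E i w w₂ ∧ E i w₂ w₃ ∧ E j w₃ x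
  comm : ∀ {i j u v w}, Far i j → E i u v → E j u w → ∃ x, E j v x ∧ E i w x

/-- The reversed edge relation. -/
def revE {V : Type} (E : ℕ → V → V → Prop) : ℕ → V → V → Prop := fun i u v => E i v u

/-- The axioms of an `A_n`-crystal, without connectedness, for an edge relation. -/
structure RelCrystal (n : ℕ) {V : Type} (E : ℕ → V → V → Prop) (h t : ℕ → V → ℕ) : Prop where
  out : HalfCrystal n E h t
  inn : HalfCrystal n (revE E) t h

theorem Neighb.symm {i j : ℕ} (hij : Neighb i j) : Neighb j i := Or.symm hij

theorem Far.symm {i j : ℕ} (hij : Far i j) : Far j i := Or.symm hij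

theorem eq_or_neighb_or_far (i j : ℕ) : i = j ∨ Neighb i j ∨ Far i j := by
  unfold Neighb Far; omega

theorem Neighb.ne {i j : ℕ} (hij : Neighb i j) : i ≠ j := by
  unfold Neighb at hij; omega

/-- One step along an edge of any color. -/
def Arrow {V : Type} (E : ℕ → V → V → Prop) (u v : V) : Prop := ∃ i, E i u v

/-- Directed reachability. -/
abbrev Reach {V : Type} (E : ℕ → V → V → Prop) : V → V → Prop := Relation.ReflTransGen (Arrow E)

theorem reach_rev {V : Type} {E : ℕ → V → V → Prop} {u v : V} :
    Reach (revE E) u v ↔ Reach E v u :=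
  Relation.reflTransGen_swap (r := Arrow E)

namespace RelCrystal

variable {n : ℕ} {V : Type} {E : ℕ → V → V → Prop} {h t : ℕ → V → ℕ}

theorem rev (C : RelCrystal n E h t) : RelCrystal n (revE E) t h := ⟨C.inn, C.out⟩

theorem inj (C : RelCrystal n E h t) {i u v w} (hu : E i u w) (hv : E i v w) : u = v :=
  C.inn.det (show revE E i w u from hu) hv

theorem t_step (C : RelCrystal n E h t) {i u v} (e : E i u v) : t i v = t i u + 1 :=
  C.inn.step (show revE E i v u from e)

end RelCrystal

namespace HalfCrystal

variable {n : ℕ} {V : Type} {E : ℕ → V → V → Prop} {h t : ℕ → V → ℕ}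

theorem pos (C : HalfCrystal n E h t) {i u v} (e : E i u v) : 0 < h i u := C.pos_iff.2 ⟨v, e⟩

theorem h_eq_zero (C : HalfCrystal n E h t) {i : ℕ} (hi : ¬ (1 ≤ i ∧ i ≤ n)) (u : V) :
    h i u = 0 := by
  by_contra h0
  obtain ⟨v, hv⟩ := C.pos_iff.1 (Nat.pos_of_ne_zero h0)
  exact hi (C.color hv)

theorem not_both_flat (C : HalfCrystal n E h t) {i j a b c} (hij : Neighb i j)
    (e₁ : E j a b) (e₂ : E i b c) (l₁ : h i b = h i a) (l₂ : h j c = h j b) : False := by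
  have hpos := C.pos e₂
  rw [l₁] at hpos
  obtain ⟨a', e₃⟩ := C.pos_iff.1 hpos
  obtain ⟨l₃, x, e₄, e₅⟩ := C.square hij.symm e₁ e₃ l₁
  obtain rfl := C.det e₂ e₄
  have := C.step e₁
  have := C.step e₅
  omega

theorem locally_confluent (C : HalfCrystal n E h t) {u v w : V} (e₁ : Arrow E u v)
    (e₂ : Arrow E u w) : ∃ x, Reach E v x ∧ Reach E w x := by
  obtain ⟨i, e₁⟩ := e₁
  obtain ⟨j, e₂⟩ := e₂
  have one : ∀ {k a b}, E k a b → Reach E a b := fun e => .single ⟨_, e⟩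
  rcases eq_or_neighb_or_far i j with rfl | hij | hij
  · obtain rfl := C.det e₁ e₂
    exact ⟨v, .refl, .refl⟩
  · rcases C.near hij (C.color e₂).1 (C.color e₂).2 e₁ with ⟨l₁, -⟩ | ⟨l₁, -⟩
    · rcases C.near hij.symm (C.color e₁).1 (C.color e₁).2 e₂ with ⟨l₂, -⟩ | ⟨l₂, -⟩
      · obtain ⟨v₂, v₃, w₂, w₃, x, a, b, c, d, e, f⟩ := C.verma hij e₁ e₂ l₁ l₂
        exact ⟨x, ((one a).trans (one b)).trans (one c), ((one d).trans (one e)).trans (one f)⟩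
      · obtain ⟨-, x, a, b⟩ := C.square hij.symm e₂ e₁ l₂
        exact ⟨x, one b, one a⟩
    · obtain ⟨-, x, a, b⟩ := C.square hij e₁ e₂ l₁
      exact ⟨x, one a, one b⟩
  · obtain ⟨x, a, b⟩ := C.comm hij e₁ e₂
    exact ⟨x, one a, one b⟩

end HalfCrystal

/-- Newman's lemma, for a relation decreasing a natural-valued measure. -/
theorem confluent_of_locally_confluent {α : Type} {r : α → α → Prop} (m : α → ℕ)
    (hm : ∀ {a b}, r a b → m b < m a)
    (hloc : ∀ {a b c}, r a b → r a c →
      ∃ d, Relation.ReflTransGen r b d ∧ Relation.ReflTransGen r c d) {a b c : α}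
    (hb : Relation.ReflTransGen r a b) (hc : Relation.ReflTransGen r a c) :
    ∃ d, Relation.ReflTransGen r b d ∧ Relation.ReflTransGen r c d := by
  induction hk : m a using Nat.strong_induction_on generalizing a b c with
  | _ k ih =>
    subst hk
    rcases hb.cases_head with rfl | ⟨b₁, ab₁, b₁b⟩
    · exact ⟨c, hc, .refl⟩
    rcases hc.cases_head with rfl | ⟨c₁, ac₁, c₁c⟩
    · exact ⟨b, .refl, hb⟩
    obtain ⟨d, b₁d, c₁d⟩ := hloc ab₁ ac₁
    obtain ⟨e, be, de⟩ := ih _ (hm ab₁) b₁b b₁d rfl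
    obtain ⟨f, ef, cf⟩ := ih _ (hm ac₁) (c₁d.trans de) c₁c rfl
    exact ⟨f, be.trans ef, cf⟩

namespace RelCrystal

variable {n : ℕ} {V : Type} {E : ℕ → V → V → Prop} {h t : ℕ → V → ℕ}

/-- Along consecutive edges of neighboring colors, exactly one of the two labels is `1`. -/
theorem label_iff (C : RelCrystal n E h t) {i j a b c} (hij : Neighb i j)
    (e₁ : E j a b) (e₂ : E i b c) : h i b = h i a + 1 ↔ h j c = h j b := by
  have ri := C.out.color e₂
  have rj := C.out.color e₁
  constructor
  · intro l₁
    by_contra l₂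
    rcases C.out.near hij.symm ri.1 ri.2 e₁ with a₁ | a₁
    · rcases C.out.near hij rj.1 rj.2 e₂ with a₂ | a₂
      · exact C.inn.not_both_flat hij.symm (show revE E i c b from e₂) e₁ a₂.2.symm a₁.2.symm
      · exact l₂ a₂.1
    · omega
  · intro l₂
    by_contra l₁
    rcases C.out.near hij.symm ri.1 ri.2 e₁ with a₁ | a₁
    · exact l₁ a₁.1
    · exact C.out.not_both_flat hij e₁ e₂ a₁.1 l₂

/-- A grading: the pairing of the weight with the sum of the positive coroots. -/
def grade (n : ℕ) (h t : ℕ → V → ℕ) (v : V) : ℤ :=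
  ∑ j ∈ Finset.Icc 1 n, (j * (n + 1 - j) : ℤ) * ((h j v : ℤ) - t j v)

theorem grade_step (C : RelCrystal n E h t) {i u v} (e : E i u v) :
    grade n h t u = grade n h t v + 2 := by
  have ri := C.out.color e
  have key : ∀ j ∈ Finset.Icc 1 n, (j * (n + 1 - j) : ℤ) * ((h j u : ℤ) - t j u) =
      (j * (n + 1 - j) : ℤ) * ((h j v : ℤ) - t j v) +
      (((if j = i then 2 * (j * (n + 1 - j) : ℤ) else 0) -
        (if j = i + 1 then (j * (n + 1 - j) : ℤ) else 0)) -
        (if j = i - 1 then (j * (n + 1 - j) : ℤ) else 0)) := by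
    intro j hj
    rw [Finset.mem_Icc] at hj
    rcases eq_or_neighb_or_far i j with rfl | hij | hij
    · rw [if_pos rfl, if_neg (by omega), if_neg (by omega), C.out.step e, C.t_step e]
      push_cast
      ring
    · have hd : ((h j u : ℤ) - t j u) = ((h j v : ℤ) - t j v) - 1 := by
        have := C.out.near hij hj.1 hj.2 e
        omega
      rw [hd, if_neg hij.ne.symm]
      rcases hij with hij | hij
      · rw [if_pos hij.symm, if_neg (by omega)]; ring
      · rw [if_neg (by omega), if_pos (by omega)]; ring
    · have h₁ := C.out.far hij e
      have h₂ : t j u = t j v := C.inn.far hij (show revE E i v u from e)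
      rw [h₁, h₂]
      unfold Far at hij
      rw [if_neg (by omega), if_neg (by omega), if_neg (by omega)]
      ring
  unfold grade
  rw [Finset.sum_congr rfl key, Finset.sum_add_distrib, Finset.sum_sub_distrib,
    Finset.sum_sub_distrib, Finset.sum_ite_eq', Finset.sum_ite_eq', Finset.sum_ite_eq',
    if_pos (Finset.mem_Icc.2 ri)]
  have h₁ : (if i + 1 ∈ Finset.Icc 1 n then (((i + 1 : ℕ) : ℤ) * (n + 1 - ((i + 1 : ℕ) : ℤ)))
      else 0) = ((i : ℤ) + 1) * (n - i) := by
    split_ifs with hi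
    · push_cast; ring
    · rw [Finset.mem_Icc] at hi
      have : n = i := by omega
      subst this; ring
  have h₂ : (if i - 1 ∈ Finset.Icc 1 n then (((i - 1 : ℕ) : ℤ) * (n + 1 - ((i - 1 : ℕ) : ℤ)))
      else 0) = ((i : ℤ) - 1) * (n + 2 - i) := by
    split_ifs with hi
    · rw [Nat.cast_sub ri.1]; push_cast; ring
    · rw [Finset.mem_Icc] at hi
      have : i = 1 := by omega
      subst this; push_cast; ring
  rw [h₁, h₂]
  ring

theorem grade_bddBelow (C : RelCrystal n E h t) : ∃ B : ℤ, ∀ v, -B ≤ grade n h t v := by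
  choose B hB using C.inn.bdd
  refine ⟨∑ j ∈ Finset.Icc 1 n, (j * (n + 1 - j) : ℤ) * B j, fun v => ?_⟩
  rw [← Finset.sum_neg_distrib]
  refine Finset.sum_le_sum fun j hj => ?_
  rw [Finset.mem_Icc] at hj
  have h₁ : (0 : ℤ) ≤ j * (n + 1 - j) := by
    have : (j : ℤ) ≤ n := by exact_mod_cast hj.2
    exact mul_nonneg (by positivity) (by linarith)
  have h₂ : -(B j : ℤ) ≤ (h j v : ℤ) - t j v := by have := hB j v; omega
  calc -((j * (n + 1 - j) : ℤ) * B j) = (j * (n + 1 - j) : ℤ) * (-(B j : ℤ)) := by ring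
    _ ≤ _ := mul_le_mul_of_nonneg_left h₂ h₁

theorem confluent (C : RelCrystal n E h t) {u v w : V} (hv : Reach E u v) (hw : Reach E u w) :
    ∃ x, Reach E v x ∧ Reach E w x := by
  obtain ⟨B, hB⟩ := C.grade_bddBelow
  refine confluent_of_locally_confluent (fun v => (grade n h t v + B).toNat) ?_
    C.out.locally_confluent hv hw
  rintro a b ⟨i, e⟩
  have := C.grade_step e
  have := hB b
  omega

theorem eq_of_reach_of_sink (C : RelCrystal n E h t) {z v : V} (hz : ∀ i, h i z = 0)
    (hv : Reach E z v) : v = z := by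
  rcases hv.cases_head with rfl | ⟨x, ⟨i, e⟩, -⟩
  · rfl
  · have := C.out.pos e
    have := hz i
    omega

theorem reach_sink (C : RelCrystal n E h t) {u v z : V} (hz : ∀ i, h i z = 0)
    (hv : Reach E u v) (huz : Reach E u z) : Reach E v z := by
  obtain ⟨x, vx, zx⟩ := C.confluent hv huz
  rwa [C.eq_of_reach_of_sink hz zx] at vx

theorem reach_of_source (C : RelCrystal n E h t) {s u v : V} (hs : ∀ i, t i s = 0)
    (hsv : Reach E s v) (huv : Reach E u v) : Reach E s u :=
  reach_rev.1 (C.rev.reach_sink hs (reach_rev.2 huv) (reach_rev.2 hsv))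

end RelCrystal

/-! ### Tensor products -/

section Tensor

variable {n : ℕ} {V W : Type}

/-- Edges of the tensor product: an operator acts on the first factor as long as its string there
is longer than the incoming string in the second factor. -/
def tensorE (E : ℕ → V → V → Prop) (h : ℕ → V → ℕ) (E' : ℕ → W → W → Prop) (t' : ℕ → W → ℕ) :
    ℕ → V × W → V × W → Prop := fun i p q =>
  (E i p.1 q.1 ∧ q.2 = p.2 ∧ t' i p.2 < h i p.1) ∨
  (E' i p.2 q.2 ∧ q.1 = p.1 ∧ h i p.1 ≤ t' i p.2)

def tensorH (h : ℕ → V → ℕ) (h' t' : ℕ → W → ℕ) : ℕ → V × W → ℕ := fun i p =>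
  h' i p.2 + (h i p.1 - t' i p.2)

def tensorT (h t : ℕ → V → ℕ) (t' : ℕ → W → ℕ) : ℕ → V × W → ℕ := fun i p =>
  t i p.1 + (t' i p.2 - h i p.1)

variable {E : ℕ → V → V → Prop} {h t : ℕ → V → ℕ} {E' : ℕ → W → W → Prop} {h' t' : ℕ → W → ℕ}

theorem tensorE_left {i : ℕ} {x x' : V} {y : W} (e : E i x x') (hlt : t' i y < h i x) :
    tensorE E h E' t' i (x, y) (x', y) := Or.inl ⟨e, rfl, hlt⟩

theorem tensorE_right {i : ℕ} {x : V} {y y' : W} (e : E' i y y') (hle : h i x ≤ t' i y) :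
    tensorE E h E' t' i (x, y) (x, y') := Or.inr ⟨e, rfl, hle⟩

theorem RelCrystal.t_far (C : RelCrystal n E h t) {i j u v} (hij : Far i j) (e : E i u v) :
    t j v = t j u := (C.inn.far hij (show revE E i v u from e)).symm

theorem tensor_square (C : RelCrystal n E h t) (D : RelCrystal n E' h' t') {i j : ℕ}
    {u v w : V × W} (hij : Neighb i j) (e₁ : tensorE E h E' t' i u v)
    (e₂ : tensorE E h E' t' j u w) (l : tensorH h h' t' j v = tensorH h h' t' j u) :
    tensorH h h' t' i w = tensorH h h' t' i u + 1 ∧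
      ∃ x, tensorE E h E' t' j v x ∧ tensorE E h E' t' i w x := by
  obtain ⟨x, y⟩ := u
  obtain ⟨x₁, y₁⟩ := v
  obtain ⟨x₂, y₂⟩ := w
  simp only [tensorH] at l ⊢
  rcases e₁ with ⟨e₁, hy, a₁⟩ | ⟨e₁, hx, a₁⟩ <;> rcases e₂ with ⟨e₂, hy', a₂⟩ | ⟨e₂, hx', a₂⟩ <;>
    dsimp only at * <;> subst_vars
  · have ri := C.out.color e₁
    have rj := C.out.color e₂
    have n₁ := C.out.near hij rj.1 rj.2 e₁
    obtain ⟨l₂, z, e₃, e₄⟩ := C.out.square hij e₁ e₂ (by omega)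
    exact ⟨by omega, (z, _), tensorE_left e₃ (by omega), tensorE_left e₄ (by omega)⟩
  · have ri := C.out.color e₁
    have rj := D.out.color e₂
    have n₁ := C.out.near hij rj.1 rj.2 e₁
    have n₂ := D.out.near hij.symm ri.1 ri.2 e₂
    have := D.out.pos e₂
    exact ⟨by omega, (x₁, y₂), tensorE_right e₂ (by omega), tensorE_left e₁ (by omega)⟩
  · have rj := C.out.color e₂
    have n₁ := D.out.near hij rj.1 rj.2 e₁
    omega
  · have ri := D.out.color e₁
    have rj := D.out.color e₂
    have n₁ := D.out.near hij rj.1 rj.2 e₁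
    obtain ⟨l₂, z, e₃, e₄⟩ := D.out.square hij e₁ e₂ (by omega)
    have n₂ := D.out.near hij.symm ri.1 ri.2 e₂
    exact ⟨by omega, (_, z), tensorE_right e₃ (by omega), tensorE_right e₄ (by omega)⟩

/-- The Verma relation when the first color acts on the left and the second on the right. -/
theorem tensor_verma_mixed (C : RelCrystal n E h t) (D : RelCrystal n E' h' t') {i j : ℕ}
    {x x₁ : V} {y y₁ : W} (hij : Neighb i j) (e₁ : E i x x₁) (a₁ : t' i y < h i x)
    (e₂ : E' j y y₁) (a₂ : h j x ≤ t' j y)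
    (l₁ : tensorH h h' t' j (x₁, y) = tensorH h h' t' j (x, y) + 1) :
    ∃ v₂ v₃ w₂ w₃ z, tensorE E h E' t' j (x₁, y) v₂ ∧ tensorE E h E' t' j v₂ v₃ ∧
      tensorE E h E' t' i v₃ z ∧ tensorE E h E' t' i (x, y₁) w₂ ∧ tensorE E h E' t' i w₂ w₃ ∧
      tensorE E h E' t' j w₃ z := by
  simp only [tensorH] at l₁
  have ri := C.out.color e₁
  have rj := D.out.color e₂
  have n₁ := C.out.near hij rj.1 rj.2 e₁
  have n₂ := D.out.near hij.symm ri.1 ri.2 e₂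
  have s₁ := C.out.step e₁
  have s₂ := D.t_step e₂
  obtain ⟨x₂, e₃⟩ := C.out.pos_iff.1 (show 0 < h j x₁ by omega)
  have q₃ := C.label_iff hij.symm e₁ e₃
  have s₃ := C.out.step e₃
  have flat : h i x₂ = h i x₁ := q₃.1 (by omega)
  by_cases hc : t' i y₁ < h i x₁
  · obtain ⟨x₃, e₄⟩ := C.out.pos_iff.1 (show 0 < h i x₁ by omega)
    obtain ⟨-, z, e₅, e₆⟩ := C.out.square hij.symm e₃ e₄ flat
    have cv := C.out.convex hij rj.1 rj.2 e₁ e₄ (by omega)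
    exact ⟨_, _, _, _, (z, y₁), tensorE_left e₃ (by omega), tensorE_right e₂ (by omega),
      tensorE_left e₅ (by omega), tensorE_left e₁ (by omega), tensorE_left e₄ (by omega),
      tensorE_left e₆ (by omega)⟩
  · obtain ⟨y₂, e₄⟩ := D.out.pos_iff.1 (show 0 < h' i y₁ by omega)
    have q₄ := (D.label_iff hij e₂ e₄).1 (by omega)
    have n₄ := D.out.near hij rj.1 rj.2 e₄
    exact ⟨_, _, _, _, (x₂, y₂), tensorE_left e₃ (by omega), tensorE_right e₂ (by omega),
      tensorE_right e₄ (by omega), tensorE_left e₁ (by omega), tensorE_right e₄ (by omega),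
      tensorE_left e₃ (by omega)⟩

/-- The Verma relation when both colors act on the right, but the first label comes from the
left factor. -/
theorem tensor_verma_right (C : RelCrystal n E h t) (D : RelCrystal n E' h' t') {i j : ℕ}
    {x : V} {y y₁ y₂ : W} (hij : Neighb i j) (e₁ : E' i y y₁) (a₁ : h i x ≤ t' i y)
    (e₂ : E' j y y₂) (a₂ : h j x = t' j y) (l₁ : h' j y₁ = h' j y) :
    ∃ v₂ v₃ w₂ w₃ z, tensorE E h E' t' j (x, y₁) v₂ ∧ tensorE E h E' t' j v₂ v₃ ∧
      tensorE E h E' t' i v₃ z ∧ tensorE E h E' t' i (x, y₂) w₂ ∧ tensorE E h E' t' i w₂ w₃ ∧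
      tensorE E h E' t' j w₃ z := by
  have ri := D.out.color e₁
  have rj := D.out.color e₂
  obtain ⟨l₂, y₃, e₃, e₄⟩ := D.out.square hij e₁ e₂ l₁
  have n₁ := D.out.near hij rj.1 rj.2 e₁
  have n₂ := D.out.near hij.symm ri.1 ri.2 e₂
  have n₃ := D.out.near hij.symm ri.1 ri.2 e₃
  have n₄ := D.out.near hij rj.1 rj.2 e₄
  have s₁ := D.out.step e₁
  have s₂ := D.out.step e₂
  have s₃ := D.out.step e₃
  have s₄ := D.out.step e₄
  have s₁' := D.t_step e₁
  have s₂' := D.t_step e₂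
  have s₄' := D.t_step e₄
  have p₁ := D.out.pos e₁
  obtain ⟨x', e₅⟩ := C.out.pos_iff.1 (show 0 < h j x by omega)
  obtain ⟨y₄, e₆⟩ := D.out.pos_iff.1 (show 0 < h' i y₃ by omega)
  have n₅ := C.out.near hij.symm ri.1 ri.2 e₅
  have s₅ := C.out.step e₅
  have q₆ := (D.label_iff hij e₃ e₆).1 (by omega)
  have n₆ := D.out.near hij rj.1 rj.2 e₆
  exact ⟨_, _, _, _, (x', y₄), tensorE_left e₅ (by omega), tensorE_right e₃ (by omega),
    tensorE_right e₆ (by omega), tensorE_right e₄ (by omega), tensorE_right e₆ (by omega),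
    tensorE_left e₅ (by omega)⟩

theorem verma_swap {U : Type} {E : ℕ → U → U → Prop} {i j : ℕ} {v w : U}
    (hv : ∃ w₂ w₃ v₂ v₃ x, E i w w₂ ∧ E i w₂ w₃ ∧ E j w₃ x ∧ E j v v₂ ∧ E j v₂ v₃ ∧ E i v₃ x) :
    ∃ v₂ v₃ w₂ w₃ x, E j v v₂ ∧ E j v₂ v₃ ∧ E i v₃ x ∧ E i w w₂ ∧ E i w₂ w₃ ∧ E j w₃ x := by
  obtain ⟨w₂, w₃, v₂, v₃, x, a, b, c, d, e, f⟩ := hv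
  exact ⟨v₂, v₃, w₂, w₃, x, d, e, f, a, b, c⟩

theorem tensor_verma (C : RelCrystal n E h t) (D : RelCrystal n E' h' t') {i j : ℕ}
    {u v w : V × W} (hij : Neighb i j) (e₁ : tensorE E h E' t' i u v)
    (e₂ : tensorE E h E' t' j u w) (l₁ : tensorH h h' t' j v = tensorH h h' t' j u + 1)
    (l₂ : tensorH h h' t' i w = tensorH h h' t' i u + 1) :
    ∃ v₂ v₃ w₂ w₃ x, tensorE E h E' t' j v v₂ ∧ tensorE E h E' t' j v₂ v₃ ∧
      tensorE E h E' t' i v₃ x ∧ tensorE E h E' t' i w w₂ ∧ tensorE E h E' t' i w₂ w₃ ∧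
      tensorE E h E' t' j w₃ x := by
  obtain ⟨x, y⟩ := u
  obtain ⟨x₁, y₁⟩ := v
  obtain ⟨x₂, y₂⟩ := w
  rcases e₁ with ⟨e₁, hy, a₁⟩ | ⟨e₁, hx, a₁⟩ <;> rcases e₂ with ⟨e₂, hy', a₂⟩ | ⟨e₂, hx', a₂⟩ <;>
    dsimp only at * <;> subst_vars
  · simp only [tensorH] at l₁ l₂
    have ri := C.out.color e₁
    have rj := C.out.color e₂
    have n₁ := C.out.near hij rj.1 rj.2 e₁
    have n₂ := C.out.near hij.symm ri.1 ri.2 e₂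
    obtain ⟨v₂, v₃, w₂, w₃, z, b₁, b₂, b₃, d₁, d₂, d₃⟩ :=
      C.out.verma hij e₁ e₂ (by omega) (by omega)
    have q₁ := C.label_iff hij.symm e₁ b₁
    have q₂ := C.label_iff hij b₂ b₃
    have q₃ := C.label_iff hij e₂ d₁
    have q₄ := C.label_iff hij.symm d₂ d₃
    have := C.out.step e₁
    have := C.out.step e₂
    have := C.out.step b₁
    have := C.out.step b₂
    have := C.out.step b₃
    have := C.out.step d₁
    have := C.out.step d₂
    have := C.out.step d₃
    have := C.out.near hij.symm ri.1 ri.2 b₁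
    have := C.out.near hij.symm ri.1 ri.2 b₂
    have := C.out.near hij.symm ri.1 ri.2 d₃
    have := C.out.near hij rj.1 rj.2 d₁
    have := C.out.near hij rj.1 rj.2 d₂
    have := C.out.near hij rj.1 rj.2 b₃
    exact ⟨_, _, _, _, (z, _), tensorE_left b₁ (by omega), tensorE_left b₂ (by omega),
      tensorE_left b₃ (by omega), tensorE_left d₁ (by omega), tensorE_left d₂ (by omega),
      tensorE_left d₃ (by omega)⟩
  · exact tensor_verma_mixed C D hij e₁ a₁ e₂ a₂ l₁
  · exact verma_swap (tensor_verma_mixed C D hij.symm e₂ a₂ e₁ a₁ l₂)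
  · have ri := D.out.color e₁
    have rj := D.out.color e₂
    have n₁ := D.out.near hij rj.1 rj.2 e₁
    have n₂ := D.out.near hij.symm ri.1 ri.2 e₂
    simp only [tensorH] at l₁ l₂
    by_cases m₁ : h' j y₁ = h' j y
    · exact tensor_verma_right C D hij e₁ a₁ e₂ (by omega) m₁
    by_cases m₂ : h' i y₂ = h' i y
    · exact verma_swap (tensor_verma_right C D hij.symm e₂ a₂ e₁ (by omega) m₂)
    obtain ⟨v₂, v₃, w₂, w₃, z, b₁, b₂, b₃, d₁, d₂, d₃⟩ :=
      D.out.verma hij e₁ e₂ (by omega) (by omega)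
    have q₁ := D.label_iff hij.symm e₁ b₁
    have q₂ := D.label_iff hij b₂ b₃
    have q₃ := D.label_iff hij e₂ d₁
    have q₄ := D.label_iff hij.symm d₂ d₃
    have := D.t_step e₁
    have := D.t_step e₂
    have := D.t_step b₁
    have := D.t_step b₂
    have := D.t_step b₃
    have := D.t_step d₁
    have := D.t_step d₂
    have := D.t_step d₃
    have := D.out.near hij.symm ri.1 ri.2 b₁
    have := D.out.near hij.symm ri.1 ri.2 b₂
    have := D.out.near hij.symm ri.1 ri.2 d₃
    have := D.out.near hij rj.1 rj.2 d₁
    have := D.out.near hij rj.1 rj.2 d₂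
    have := D.out.near hij rj.1 rj.2 b₃
    exact ⟨_, _, _, _, (_, z), tensorE_right b₁ (by omega), tensorE_right b₂ (by omega),
      tensorE_right b₃ (by omega), tensorE_right d₁ (by omega), tensorE_right d₂ (by omega),
      tensorE_right d₃ (by omega)⟩

theorem tensor_half (C : RelCrystal n E h t) (D : RelCrystal n E' h' t') :
    HalfCrystal n (tensorE E h E' t') (tensorH h h' t') (tensorT h t t') where
  color := by
    rintro i u v (⟨e, -, -⟩ | ⟨e, -, -⟩)
    · exact C.out.color e
    · exact D.out.color e
  det := by
    rintro i ⟨x, y⟩ ⟨x₁, y₁⟩ ⟨x₂, y₂⟩ (⟨e, a, b⟩ | ⟨e, a, b⟩) (⟨e', a', b'⟩ | ⟨e', a', b'⟩) <;>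
      dsimp only at * <;> subst_vars
    · rw [C.out.det e e']
    · omega
    · omega
    · rw [D.out.det e e']
  pos_iff := by
    rintro i ⟨x, y⟩
    constructor
    · intro hp
      simp only [tensorH] at hp
      by_cases hc : t' i y < h i x
      · obtain ⟨x', e⟩ := C.out.pos_iff.1 (show 0 < h i x by omega)
        exact ⟨_, tensorE_left e hc⟩
      · obtain ⟨y', e⟩ := D.out.pos_iff.1 (show 0 < h' i y by omega)
        exact ⟨_, tensorE_right e (by omega)⟩
    · rintro ⟨v, ⟨e, a, b⟩ | ⟨e, a, b⟩⟩ <;> simp only [tensorH] at *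
      · omega
      · have := D.out.pos e
        omega
  step := by
    rintro i ⟨x, y⟩ ⟨x₁, y₁⟩ (⟨e, a, b⟩ | ⟨e, a, b⟩) <;> simp only [tensorH] at * <;> subst_vars
    · have := C.out.step e
      omega
    · have := D.out.step e
      have := D.t_step e
      omega
  bdd := by
    intro i
    obtain ⟨B, hB⟩ := C.out.bdd i
    obtain ⟨B', hB'⟩ := D.out.bdd i
    refine ⟨B' + B, fun v => ?_⟩
    have := hB v.1
    have := hB' v.2
    simp only [tensorH]
    omega
  far := by
    rintro i j ⟨x, y⟩ ⟨x₁, y₁⟩ hij (⟨e, a, b⟩ | ⟨e, a, b⟩) <;> simp only [tensorH] at * <;>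
      subst_vars
    · rw [C.out.far hij e]
    · rw [D.out.far hij e, D.t_far hij e]
  near := by
    rintro i j ⟨x, y⟩ ⟨x₁, y₁⟩ hij r₁ r₂ (⟨e, a, b⟩ | ⟨e, a, b⟩) <;>
      simp only [tensorH, tensorT] at * <;> subst_vars
    · have := C.out.near hij r₁ r₂ e
      omega
    · have := D.out.near hij r₁ r₂ e
      omega
  convex := by
    rintro i j ⟨x, y⟩ ⟨x₁, y₁⟩ ⟨x₂, y₂⟩ hij r₁ r₂ (⟨e, a, b⟩ | ⟨e, a, b⟩)
      (⟨e', a', b'⟩ | ⟨e', a', b'⟩) l <;>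
      simp only [tensorH] at * <;> subst_vars
    · have := C.out.near hij r₁ r₂ e
      have := C.out.near hij r₁ r₂ e'
      have := C.out.convex hij r₁ r₂ e e'
      omega
    · have := C.out.near hij r₁ r₂ e
      have := D.out.near hij r₁ r₂ e'
      omega
    · have := D.t_step e
      omega
    · have := D.out.near hij r₁ r₂ e
      have := D.out.near hij r₁ r₂ e'
      have := D.out.convex hij r₁ r₂ e e'
      omega
  square := tensor_square C D
  verma := tensor_verma C D
  comm := by
    rintro i j ⟨x, y⟩ ⟨x₁, y₁⟩ ⟨x₂, y₂⟩ hij (⟨e, a, b⟩ | ⟨e, a, b⟩)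
      (⟨e', a', b'⟩ | ⟨e', a', b'⟩) <;>
      dsimp only at * <;> subst_vars
    · obtain ⟨z, f, g⟩ := C.out.comm hij e e'
      have := C.out.far hij e
      have := C.out.far hij.symm e'
      exact ⟨(z, _), tensorE_left f (by omega), tensorE_left g (by omega)⟩
    · have := C.out.far hij e
      have := D.t_far hij.symm e'
      exact ⟨(_, _), tensorE_right e' (by omega), tensorE_left e (by omega)⟩
    · have := C.out.far hij.symm e'
      have := D.t_far hij e
      exact ⟨(_, _), tensorE_left e' (by omega), tensorE_right e (by omega)⟩
    · obtain ⟨z, f, g⟩ := D.out.comm hij e e'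
      have := D.t_far hij e
      have := D.t_far hij.symm e'
      exact ⟨(_, z), tensorE_right f (by omega), tensorE_right g (by omega)⟩

end Tensor

/-- The outgoing axioms pull back along an injective map that is full on edges and whose image is
closed under outgoing edges. -/
theorem HalfCrystal.comap {n : ℕ} {V W : Type} {E : ℕ → V → V → Prop} {h t : ℕ → V → ℕ}
    (C : HalfCrystal n E h t) {E' : ℕ → W → W → Prop} (f : W → V) (hf : Function.Injective f)
    (hE : ∀ {i u v}, E' i u v ↔ E i (f u) (f v))
    (hclosed : ∀ {i u y}, E i (f u) y → ∃ v, f v = y) :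
    HalfCrystal n E' (fun i u => h i (f u)) (fun i u => t i (f u)) where
  color e := C.color (hE.1 e)
  det e e' := hf (C.det (hE.1 e) (hE.1 e'))
  pos_iff := by
    intro i u
    rw [C.pos_iff]
    constructor
    · rintro ⟨y, e⟩
      obtain ⟨v, rfl⟩ := hclosed e
      exact ⟨v, hE.2 e⟩
    · rintro ⟨v, e⟩
      exact ⟨_, hE.1 e⟩
  step e := C.step (hE.1 e)
  bdd i := (C.bdd i).imp fun B hB v => hB (f v)
  far hij e := C.far hij (hE.1 e)
  near hij r₁ r₂ e := C.near hij r₁ r₂ (hE.1 e)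
  convex hij r₁ r₂ e e' l := C.convex hij r₁ r₂ (hE.1 e) (hE.1 e') l
  square := by
    intro i j u v w hij e e' l
    obtain ⟨l', x, a, b⟩ := C.square hij (hE.1 e) (hE.1 e') l
    obtain ⟨x, rfl⟩ := hclosed a
    exact ⟨l', x, hE.2 a, hE.2 b⟩
  verma := by
    intro i j u v w hij e e' l l'
    obtain ⟨v₂, v₃, w₂, w₃, x, a, b, c, a', b', c'⟩ := C.verma hij (hE.1 e) (hE.1 e') l l'
    obtain ⟨v₂, rfl⟩ := hclosed a
    obtain ⟨v₃, rfl⟩ := hclosed b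
    obtain ⟨x, rfl⟩ := hclosed c
    obtain ⟨w₂, rfl⟩ := hclosed a'
    obtain ⟨w₃, rfl⟩ := hclosed b'
    exact ⟨v₂, v₃, w₂, w₃, x, hE.2 a, hE.2 b, hE.2 c, hE.2 a', hE.2 b', hE.2 c'⟩
  comm := by
    intro i j u v w hij e e'
    obtain ⟨x, a, b⟩ := C.comm hij (hE.1 e) (hE.1 e')
    obtain ⟨x, rfl⟩ := hclosed a
    exact ⟨x, hE.2 a, hE.2 b⟩

theorem RelCrystal.comap {n : ℕ} {V W : Type} {E : ℕ → V → V → Prop} {h t : ℕ → V → ℕ}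
    (C : RelCrystal n E h t) {E' : ℕ → W → W → Prop} (f : W → V) (hf : Function.Injective f)
    (hE : ∀ {i u v}, E' i u v ↔ E i (f u) (f v))
    (hout : ∀ {i u y}, E i (f u) y → ∃ v, f v = y)
    (hinn : ∀ {i u y}, E i y (f u) → ∃ v, f v = y) :
    RelCrystal n E' (fun i u => h i (f u)) (fun i u => t i (f u)) :=
  ⟨C.out.comap f hf hE hout, C.inn.comap f hf (E' := revE E') hE hinn⟩

/-- The tensor product of two crystals is a crystal. -/
theorem RelCrystal.tensor {n : ℕ} {V W : Type} {E : ℕ → V → V → Prop} {h t : ℕ → V → ℕ}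
    {E' : ℕ → W → W → Prop} {h' t' : ℕ → W → ℕ} (C : RelCrystal n E h t)
    (D : RelCrystal n E' h' t') :
    RelCrystal n (tensorE E h E' t') (tensorH h h' t') (tensorT h t t') := by
  refine ⟨tensor_half C D, ?_⟩
  refine (tensor_half D.rev C.rev).comap Prod.swap Prod.swap_injective ?_
    fun {i u y} _ => ⟨y.swap, Prod.swap_swap y⟩
  rintro i ⟨x, y⟩ ⟨x₁, y₁⟩
  simp only [revE, tensorE, Prod.fst_swap, Prod.snd_swap, eq_comm (a := y₁), eq_comm (a := x₁)]
  rw [or_comm]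
  refine or_congr ⟨?_, ?_⟩ ⟨?_, ?_⟩
  · rintro ⟨e, rfl, l⟩
    have := D.t_step e
    exact ⟨e, rfl, by omega⟩
  · rintro ⟨e, rfl, l⟩
    have := D.t_step e
    exact ⟨e, rfl, by omega⟩
  · rintro ⟨e, rfl, l⟩
    have := C.out.step e
    exact ⟨e, rfl, by omega⟩
  · rintro ⟨e, rfl, l⟩
    have := C.out.step e
    exact ⟨e, rfl, by omega⟩

/-! ### Uniqueness of the crystal with a given parameter -/

/-- `Level E s m u`: there is a directed path with `m` edges from `s` to `u`. -/
inductive Level {V : Type} (E : ℕ → V → V → Prop) (s : V) : ℕ → V → Prop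
  | base : Level E s 0 s
  | step {m i u v} : Level E s m u → E i u v → Level E s (m + 1) v

/-- `Twin E E' s s' m u u'`: some string of `m` operators takes `s` to `u` and `s'` to `u'`. -/
inductive Twin {V V' : Type} (E : ℕ → V → V → Prop) (E' : ℕ → V' → V' → Prop) (s : V) (s' : V') :
    ℕ → V → V' → Prop
  | base : Twin E E' s s' 0 s s'
  | step {m i u v u' v'} : Twin E E' s s' m u u' → E i u v → E' i u' v' →
      Twin E E' s s' (m + 1) v v'

section Twin

variable {V V' : Type} {E : ℕ → V → V → Prop} {E' : ℕ → V' → V' → Prop} {s : V} {s' : V'}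

theorem Twin.symm {m u u'} (T : Twin E E' s s' m u u') : Twin E' E s' s m u' u := by
  induction T with
  | base => exact .base
  | step _ e e' ih => exact .step ih e' e

theorem Twin.level {m u u'} (T : Twin E E' s s' m u u') : Level E s m u := by
  induction T with
  | base => exact .base
  | step _ e e' ih => exact .step ih e

theorem Level.reach {m u} (L : Level E s m u) : Reach E s u := by
  induction L with
  | base => exact .refl
  | step _ e ih => exact ih.tail ⟨_, e⟩

theorem exists_level {u} (r : Reach E s u) : ∃ m, Level E s m u := by
  induction r with
  | refl => exact ⟨0, .base⟩
  | tail _ e ih =>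
    obtain ⟨m, L⟩ := ih
    obtain ⟨i, e⟩ := e
    exact ⟨m + 1, .step L e⟩

variable {n : ℕ} {h t : ℕ → V → ℕ} {h' t' : ℕ → V' → ℕ}

theorem Level.grade_eq (C : RelCrystal n E h t) {m u} (L : Level E s m u) :
    RelCrystal.grade n h t s = RelCrystal.grade n h t u + 2 * m := by
  induction L with
  | base => simp
  | step _ e ih => rw [ih, C.grade_step e]; push_cast; ring

theorem Level.unique (C : RelCrystal n E h t) {m k u} (L : Level E s m u) (L' : Level E s k u) :
    m = k := by
  have := L.grade_eq C
  have := L'.grade_eq C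
  omega

theorem Level.pred (C : RelCrystal n E h t) (hs : ∀ i, t i s = 0) {m i u v} (L : Level E s m v)
    (e : E i u v) : ∃ k, m = k + 1 ∧ Level E s k u := by
  obtain ⟨k, hk⟩ := exists_level (C.reach_of_source hs L.reach (.single ⟨i, e⟩))
  exact ⟨k, L.unique C (.step hk e), hk⟩

/-- String lengths agree on twins at level `m`. -/
def TwinLengths (E : ℕ → V → V → Prop) (E' : ℕ → V' → V' → Prop) (s : V) (s' : V')
    (h t : ℕ → V → ℕ) (h' t' : ℕ → V' → ℕ) (m : ℕ) : Prop :=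
  ∀ ⦃u x⦄, Twin E E' s s' m u x → ∀ i, h i u = h' i x ∧ t i u = t' i x

/-- A vertex has at most one twin at level `m`. -/
def TwinUnique (E : ℕ → V → V → Prop) (E' : ℕ → V' → V' → Prop) (s : V) (s' : V') (m : ℕ) : Prop :=
  ∀ ⦃u u' u''⦄, Twin E E' s s' m u u' → Twin E E' s s' m u u'' → u' = u''

theorem TwinLengths.symm {m} (T : TwinLengths E E' s s' h t h' t' m) :
    TwinLengths E' E s' s h' t' h t m :=
  fun _ _ tw i => ⟨(T tw.symm i).1.symm, (T tw.symm i).2.symm⟩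

theorem Level.exists_twin (C : RelCrystal n E h t) (C' : RelCrystal n E' h' t') {m u}
    (L : Level E s m u) (H : ∀ k < m, TwinLengths E E' s s' h t h' t' k) :
    ∃ u', Twin E E' s s' m u u' := by
  induction L with
  | base => exact ⟨s', .base⟩
  | @step m i u v _ e ih =>
    obtain ⟨u', tw⟩ := ih fun k hk => H k (by omega)
    have hp := C.out.pos e
    rw [(H m (by omega) tw i).1] at hp
    obtain ⟨v', e'⟩ := C'.out.pos_iff.1 hp
    exact ⟨v', .step tw e e'⟩

theorem Twin.exists_edge (C : RelCrystal n E h t) (C' : RelCrystal n E' h' t') {m i z u z' u'}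
    (H : TwinLengths E E' s s' h t h' t' m) (U : TwinUnique E E' s s' (m + 1))
    (tz : Twin E E' s s' m z z') (tu : Twin E E' s s' (m + 1) u u') (e : E i z u) :
    E' i z' u' := by
  have hp := C.out.pos e
  rw [(H tz i).1] at hp
  obtain ⟨x, hx⟩ := C'.out.pos_iff.1 hp
  rwa [U tu (.step tz e hx)]

/-- If `v` is the bottom of a commuting square with `l_j(u, v) = 1`, its twins agree. -/
theorem twin_unique_square (C : RelCrystal n E h t) (C' : RelCrystal n E' h' t')
    (hs : ∀ i, t i s = 0) {m i j : ℕ} (H : ∀ k ≤ m, TwinLengths E E' s s' h t h' t' k)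
    (U : ∀ k ≤ m, TwinUnique E E' s s' k) (hij : Neighb i j) {u w v : V} {u' w' v₁ v₂ : V'}
    (tu : Twin E E' s s' m u u') (tw : Twin E E' s s' m w w') (e₁ : E i u v) (e₂ : E j w v)
    (e₁' : E' i u' v₁) (e₂' : E' j w' v₂) (l : t j u = t j v) : v₁ = v₂ := by
  have ri := C.out.color e₁
  obtain ⟨lw, z, f₁, f₂⟩ := C.inn.square hij (show revE E i v u from e₁) e₂ l
  replace f₁ : E j z u := f₁
  replace f₂ : E i z w := f₂
  obtain ⟨k, rfl, Lz⟩ := tu.level.pred C hs f₁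
  obtain ⟨z', tz⟩ := Lz.exists_twin C C' fun k' hk' => H k' (by omega)
  have g₁ := tz.exists_edge C C' (H k (by omega)) (U _ le_rfl) tu f₁
  have g₂ := tz.exists_edge C C' (H k (by omega)) (U _ le_rfl) tw f₂
  have flat : h' i u' = h' i z' := by
    rw [← (H _ le_rfl tu i).1, ← (H k (by omega) tz i).1]
    have := C.out.near hij.symm ri.1 ri.2 e₂
    have := C.out.step e₁
    have := C.out.step f₂
    omega
  obtain ⟨-, x, k₁, k₂⟩ := C'.out.square hij.symm g₁ g₂ flat
  rw [C'.out.det e₁' k₁, C'.out.det e₂' k₂]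

theorem twin_unique_verma (C : RelCrystal n E h t) (C' : RelCrystal n E' h' t')
    (hs : ∀ i, t i s = 0) {m i j : ℕ} (H : ∀ k ≤ m, TwinLengths E E' s s' h t h' t' k)
    (U : ∀ k ≤ m, TwinUnique E E' s s' k) (hij : Neighb i j) {u w v : V} {u' w' v₁ v₂ : V'}
    (tu : Twin E E' s s' m u u') (tw : Twin E E' s s' m w w') (e₁ : E i u v) (e₂ : E j w v)
    (e₁' : E' i u' v₁) (e₂' : E' j w' v₂) (l₁ : t j u = t j v + 1) (l₂ : t i w = t i v + 1) :
    v₁ = v₂ := by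
  have ri := C.out.color e₁
  have rj := C.out.color e₂
  obtain ⟨a₂, a₃, b₂, b₃, z, f₁, f₂, f₃, g₁, g₂, g₃⟩ :=
    C.inn.verma hij (show revE E i v u from e₁) e₂ l₁ l₂
  replace f₁ : E j a₂ u := f₁
  replace f₂ : E j a₃ a₂ := f₂
  replace f₃ : E i z a₃ := f₃
  replace g₁ : E i b₂ w := g₁
  replace g₂ : E i b₃ b₂ := g₂
  replace g₃ : E j z b₃ := g₃
  have ne₁ := C.out.near hij rj.1 rj.2 e₁
  have ne₂ := C.out.near hij.symm ri.1 ri.2 e₂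
  have lab₁ : h j a₃ = h j z + 1 := by
    have := C.label_iff hij.symm g₁ e₂
    have := C.out.near hij rj.1 rj.2 g₂
    have := C.out.near hij rj.1 rj.2 g₁
    have := C.out.near hij rj.1 rj.2 f₃
    have := C.out.step f₁
    have := C.out.step f₂
    have := C.out.step g₃
    have := C.out.step e₂
    omega
  have lab₂ : h i b₃ = h i z + 1 := by
    have := C.label_iff hij f₁ e₁
    have := C.out.near hij.symm ri.1 ri.2 f₂
    have := C.out.near hij.symm ri.1 ri.2 f₁
    have := C.out.near hij.symm ri.1 ri.2 g₃
    have := C.out.step g₁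
    have := C.out.step g₂
    have := C.out.step f₃
    have := C.out.step e₁
    omega
  obtain ⟨k, rfl, La₂⟩ := tu.level.pred C hs f₁
  obtain ⟨k, rfl, La₃⟩ := La₂.pred C hs f₂
  obtain ⟨k, rfl, Lz⟩ := La₃.pred C hs f₃
  have lift : ∀ {q x}, q ≤ k + 2 → Level E s q x → ∃ x', Twin E E' s s' q x x' :=
    fun hq L => L.exists_twin C C' fun k' hk' => H k' (by omega)
  obtain ⟨z', tz⟩ := lift (by omega) Lz
  obtain ⟨a₃', ta₃⟩ := lift (by omega) La₃
  obtain ⟨a₂', ta₂⟩ := lift (by omega) La₂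
  obtain ⟨b₃', tb₃⟩ := lift (by omega) (Level.step Lz g₃)
  obtain ⟨b₂', tb₂⟩ := lift (by omega) (Level.step (Level.step Lz g₃) g₂)
  have f₃' := tz.exists_edge C C' (H _ (by omega)) (U _ (by omega)) ta₃ f₃
  have f₂' := ta₃.exists_edge C C' (H _ (by omega)) (U _ (by omega)) ta₂ f₂
  have f₁' := ta₂.exists_edge C C' (H _ (by omega)) (U _ (by omega)) tu f₁
  have g₃' := tz.exists_edge C C' (H _ (by omega)) (U _ (by omega)) tb₃ g₃
  have g₂' := tb₃.exists_edge C C' (H _ (by omega)) (U _ (by omega)) tb₂ g₂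
  have g₁' := tb₂.exists_edge C C' (H _ (by omega)) (U _ (by omega)) tw g₁
  rw [(H _ (by omega) ta₃ j).1, (H _ (by omega) tz j).1] at lab₁
  rw [(H _ (by omega) tb₃ i).1, (H _ (by omega) tz i).1] at lab₂
  obtain ⟨c₂, c₃, d₂, d₃, x, p₁, p₂, p₃, q₁, q₂, q₃⟩ := C'.out.verma hij f₃' g₃' lab₁ lab₂
  obtain rfl := C'.out.det f₂' p₁
  obtain rfl := C'.out.det f₁' p₂
  obtain rfl := C'.out.det g₂' q₁
  obtain rfl := C'.out.det g₁' q₂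
  rw [C'.out.det e₁' p₃, C'.out.det e₂' q₃]

theorem twinUnique_succ (C : RelCrystal n E h t) (C' : RelCrystal n E' h' t')
    (hs : ∀ i, t i s = 0) {m : ℕ} (H : ∀ k ≤ m, TwinLengths E E' s s' h t h' t' k)
    (U : ∀ k ≤ m, TwinUnique E E' s s' k) : TwinUnique E E' s s' (m + 1) := by
  intro v v₁ v₂ T₁ T₂
  cases T₁ with
  | @step _ i u _ u' _ tu e₁ e₁' =>
  cases T₂ with
  | @step _ j w _ w' _ tw e₂ e₂' =>
  rcases eq_or_neighb_or_far i j with rfl | hij | hij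
  · obtain rfl := C.inj e₁ e₂
    obtain rfl := U m le_rfl tu tw
    exact C'.out.det e₁' e₂'
  · have ri := C.out.color e₁
    have rj := C.out.color e₂
    rcases C.out.near hij rj.1 rj.2 e₁ with l₁ | l₁
    · exact twin_unique_square C C' hs H U hij tu tw e₁ e₂ e₁' e₂' l₁.2.symm
    rcases C.out.near hij.symm ri.1 ri.2 e₂ with l₂ | l₂
    · exact (twin_unique_square C C' hs H U hij.symm tw tu e₂ e₁ e₂' e₁' l₂.2.symm).symm
    exact twin_unique_verma C C' hs H U hij tu tw e₁ e₂ e₁' e₂' l₁.2 l₂.2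
  · obtain ⟨z, f₁, f₂⟩ := C.inn.comm hij (show revE E i v u from e₁) e₂
    replace f₁ : E j z u := f₁
    replace f₂ : E i z w := f₂
    obtain ⟨k, rfl, Lz⟩ := tu.level.pred C hs f₁
    obtain ⟨z', tz⟩ := Lz.exists_twin C C' fun k' hk' => H k' (by omega)
    have g₁ := tz.exists_edge C C' (H k (by omega)) (U _ le_rfl) tu f₁
    have g₂ := tz.exists_edge C C' (H k (by omega)) (U _ le_rfl) tw f₂
    obtain ⟨x, k₁, k₂⟩ := C'.out.comm hij.symm g₁ g₂
    rw [C'.out.det e₁' k₁, C'.out.det e₂' k₂]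

theorem Twin.exists_pred (C : RelCrystal n E h t) (C' : RelCrystal n E' h' t')
    (hs : ∀ i, t i s = 0) {m : ℕ} (H : ∀ k ≤ m, TwinLengths E E' s s' h t h' t' k)
    (U : TwinUnique E E' s s' (m + 1)) {i u v v'} (T : Twin E E' s s' (m + 1) v v')
    (e : E i u v) : ∃ u', E' i u' v' ∧ Twin E E' s s' m u u' := by
  obtain ⟨k, hk, Lu⟩ := T.level.pred C hs e
  obtain rfl : m = k := by omega
  obtain ⟨u', tu⟩ := Lu.exists_twin C C' fun k' hk' => H k' (by omega)
  exact ⟨u', tu.exists_edge C C' (H m le_rfl) U T e, tu⟩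

theorem twinLengths_succ (C : RelCrystal n E h t) (C' : RelCrystal n E' h' t')
    (hs : ∀ i, t i s = 0) (hs' : ∀ i, t' i s' = 0) {m : ℕ}
    (H : ∀ k ≤ m, TwinLengths E E' s s' h t h' t' k)
    (U : TwinUnique E E' s s' (m + 1)) (U' : TwinUnique E' E s' s (m + 1)) :
    TwinLengths E E' s s' h t h' t' (m + 1) := by
  intro v v' T i
  have ht : t i v = t' i v' := by
    by_cases h₁ : 0 < t i v
    · obtain ⟨u, e⟩ := C.inn.pos_iff.1 h₁
      obtain ⟨u', e', tu⟩ := T.exists_pred C C' hs H U e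
      rw [C.t_step e, C'.t_step e', (H m le_rfl tu i).2]
    · by_contra hne
      obtain ⟨u', e'⟩ := C'.inn.pos_iff.1 (show 0 < t' i v' by omega)
      obtain ⟨u, e, -⟩ := T.symm.exists_pred C' C hs' (fun k hk => (H k hk).symm) U' e'
      have := C.t_step e
      omega
  refine ⟨?_, ht⟩
  by_cases ri : 1 ≤ i ∧ i ≤ n
  · cases T with
    | @step _ j u _ u' _ tu e e' =>
    have hu := H m le_rfl tu i
    rcases eq_or_neighb_or_far j i with rfl | hij | hij
    · have := C.out.step e
      have := C'.out.step e'
      omega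
    · have := C.out.near hij ri.1 ri.2 e
      have := C'.out.near hij ri.1 ri.2 e'
      omega
    · rw [C.out.far hij e, C'.out.far hij e', hu.1]
  · rw [C.out.h_eq_zero ri, C'.out.h_eq_zero ri]

theorem twin_main (C : RelCrystal n E h t) (C' : RelCrystal n E' h' t')
    (hs : ∀ i, t i s = 0) (hs' : ∀ i, t' i s' = 0) (hh : ∀ i, h i s = h' i s') (m : ℕ) :
    TwinLengths E E' s s' h t h' t' m ∧ TwinUnique E E' s s' m ∧ TwinUnique E' E s' s m := by
  induction m using Nat.strong_induction_on with
  | _ m ih =>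
    cases m with
    | zero =>
      refine ⟨fun _ _ T i => ?_, fun _ _ _ T₁ T₂ => ?_, fun _ _ _ T₁ T₂ => ?_⟩
      · cases T
        exact ⟨hh i, by rw [hs, hs']⟩
      · cases T₁
        cases T₂
        rfl
      · cases T₁
        cases T₂
        rfl
    | succ m =>
      have H : ∀ k ≤ m, TwinLengths E E' s s' h t h' t' k := fun k hk => (ih k (by omega)).1
      have U := twinUnique_succ C C' hs H fun k hk => (ih k (by omega)).2.1
      have U' := twinUnique_succ C' C hs' (fun k hk => (H k hk).symm)
        fun k hk => (ih k (by omega)).2.2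
      exact ⟨twinLengths_succ C C' hs hs' H U U', U, U'⟩

end Twin

/-- A partial bijection between two edge-colored graphs that respects outgoing edges. -/
structure Matching {V V' : Type} (E : ℕ → V → V → Prop) (E' : ℕ → V' → V' → Prop)
    (h : ℕ → V → ℕ) (h' : ℕ → V' → ℕ) (M : V → V' → Prop) : Prop where
  fwd : ∀ {i u v u'}, M u u' → E i u v → ∃ v', E' i u' v' ∧ M v v'
  bwd : ∀ {i u u' v'}, M u u' → E' i u' v' → ∃ v, E i u v ∧ M v v'
  uniq : ∀ {u u' u''}, M u u' → M u u'' → u' = u''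
  inj : ∀ {u v u'}, M u u' → M v u' → u = v
  length : ∀ {u x}, M u x → ∀ i, h i u = h' i x

/-- Crystals with sources of equal parameters match. -/
theorem exists_matching {n : ℕ} {V V' : Type} {E : ℕ → V → V → Prop} {E' : ℕ → V' → V' → Prop}
    {h t : ℕ → V → ℕ} {h' t' : ℕ → V' → ℕ} {s : V} {s' : V'} (C : RelCrystal n E h t)
    (C' : RelCrystal n E' h' t') (hs : ∀ i, t i s = 0) (hs' : ∀ i, t' i s' = 0)
    (hh : ∀ i, 1 ≤ i → i ≤ n → h i s = h' i s') : ∃ M, Matching E E' h h' M ∧ M s s' := by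
  have hh' : ∀ i, h i s = h' i s' := fun i => by
    by_cases ri : 1 ≤ i ∧ i ≤ n
    · exact hh i ri.1 ri.2
    · rw [C.out.h_eq_zero ri, C'.out.h_eq_zero ri]
  have main := fun m => twin_main C C' hs hs' hh' m
  refine ⟨fun u u' => ∃ m, Twin E E' s s' m u u', ⟨?_, ?_, ?_, ?_, ?_⟩, 0, .base⟩
  · rintro i u v u' ⟨m, T⟩ e
    have hp := C.out.pos e
    rw [((main m).1 T i).1] at hp
    obtain ⟨v', e'⟩ := C'.out.pos_iff.1 hp
    exact ⟨v', e', m + 1, .step T e e'⟩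
  · rintro i u u' v' ⟨m, T⟩ e'
    have hp := C'.out.pos e'
    rw [← ((main m).1 T i).1] at hp
    obtain ⟨v, e⟩ := C.out.pos_iff.1 hp
    exact ⟨v, e, m + 1, .step T e e'⟩
  · rintro u u' u'' ⟨m, T⟩ ⟨k, T'⟩
    obtain rfl := T.level.unique C T'.level
    exact (main m).2.1 T T'
  · rintro u v u' ⟨m, T⟩ ⟨k, T'⟩
    obtain rfl := T.symm.level.unique C' T'.symm.level
    exact (main m).2.2 T.symm T'.symm
  · rintro u u' ⟨m, T⟩ i
    exact ((main m).1 T i).1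

/-! ### Operator strings -/

/-- `v` is obtained from `u` by following the colors of a list, head first. -/
def Run {V : Type} (E : ℕ → V → V → Prop) : List ℕ → V → V → Prop
  | [], u, v => u = v
  | i :: L, u, v => ∃ w, E i u w ∧ Run E L w v

section Run

variable {n : ℕ} {V V' : Type} {E : ℕ → V → V → Prop} {E' : ℕ → V' → V' → Prop}
  {h t : ℕ → V → ℕ} {h' t' : ℕ → V' → ℕ}

theorem run_append {L L' : List ℕ} {u v : V} :
    Run E (L ++ L') u v ↔ ∃ w, Run E L u w ∧ Run E L' w v := by
  induction L generalizing u with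
  | nil => simp [Run]
  | cons i L ih =>
    simp only [List.cons_append, Run, ih]
    constructor
    · rintro ⟨w, e, x, a, b⟩
      exact ⟨x, ⟨w, e, a⟩, b⟩
    · rintro ⟨x, ⟨w, e, a⟩, b⟩
      exact ⟨w, e, x, a, b⟩

theorem Run.reach {L : List ℕ} {u v : V} (r : Run E L u v) : Reach E u v := by
  induction L generalizing u with
  | nil => cases r; exact .refl
  | cons i L ih =>
    obtain ⟨w, e, r⟩ := r
    exact .head ⟨i, e⟩ (ih r)

theorem Run.det (C : HalfCrystal n E h t) {L : List ℕ} {u v w : V} (r : Run E L u v)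
    (r' : Run E L u w) : v = w := by
  induction L generalizing u with
  | nil => exact Eq.trans (Eq.symm r) r'
  | cons i L ih =>
    obtain ⟨x, e, r⟩ := r
    obtain ⟨x', e', r'⟩ := r'
    obtain rfl := C.det e e'
    exact ih r r'

theorem Run.map {f : V → V'} (hf : ∀ {i u v}, E i u v → E' i (f u) (f v)) {L : List ℕ} {u v : V}
    (r : Run E L u v) : Run E' L (f u) (f v) := by
  induction L generalizing u with
  | nil => cases r; rfl
  | cons i L ih =>
    obtain ⟨w, e, r⟩ := r
    exact ⟨f w, hf e, ih r⟩

theorem Matching.run_fwd {M : V → V' → Prop} (H : Matching E E' h h' M) {L : List ℕ} {u v u'}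
    (m : M u u') (r : Run E L u v) : ∃ v', Run E' L u' v' ∧ M v v' := by
  induction L generalizing u u' with
  | nil => cases r; exact ⟨u', rfl, m⟩
  | cons i L ih =>
    obtain ⟨w, e, r⟩ := r
    obtain ⟨w', e', m'⟩ := H.fwd m e
    obtain ⟨v', r', mv⟩ := ih m' r
    exact ⟨v', ⟨w', e', r'⟩, mv⟩

theorem Matching.run_bwd {M : V → V' → Prop} (H : Matching E E' h h' M) {L : List ℕ} {u u' v'}
    (m : M u u') (r : Run E' L u' v') : ∃ v, Run E L u v ∧ M v v' := by
  induction L generalizing u u' with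
  | nil => cases r; exact ⟨u, rfl, m⟩
  | cons i L ih =>
    obtain ⟨w', e', r⟩ := r
    obtain ⟨w, e, m'⟩ := H.bwd m e'
    obtain ⟨v, r', mv⟩ := ih m' r
    exact ⟨v, ⟨w, e, r'⟩, mv⟩

theorem Matching.reach_fwd {M : V → V' → Prop} (H : Matching E E' h h' M) {u v u'}
    (m : M u u') (r : Reach E u v) : ∃ v', Reach E' u' v' ∧ M v v' := by
  induction r with
  | refl => exact ⟨u', .refl, m⟩
  | tail _ e ih =>
    obtain ⟨x', r', mx⟩ := ih
    obtain ⟨i, e⟩ := e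
    obtain ⟨v', e', mv⟩ := H.fwd mx e
    exact ⟨v', r'.tail ⟨i, e'⟩, mv⟩

theorem Matching.reach_bwd {M : V → V' → Prop} (H : Matching E E' h h' M) {u u' v'}
    (m : M u u') (r : Reach E' u' v') : ∃ v, Reach E u v ∧ M v v' := by
  induction r with
  | refl => exact ⟨u, .refl, m⟩
  | tail _ e ih =>
    obtain ⟨x, r', mx⟩ := ih
    obtain ⟨i, e⟩ := e
    obtain ⟨v, e', mv⟩ := H.bwd mx e
    exact ⟨v, r'.tail ⟨i, e'⟩, mv⟩

end Run

section TensorRun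

variable {n : ℕ} {V W : Type} {E : ℕ → V → V → Prop} {h t : ℕ → V → ℕ}
  {E' : ℕ → W → W → Prop} {h' t' : ℕ → W → ℕ}

theorem Run.tensor_left (C : HalfCrystal n E h t) {s : W} (hs : ∀ i, t' i s = 0) {L : List ℕ}
    {x x' : V} (r : Run E L x x') : Run (tensorE E h E' t') L (x, s) (x', s) :=
  r.map (f := fun x => (x, s)) fun e => tensorE_left e (by rw [hs]; exact C.pos e)

theorem Run.tensor_right {z : V} (hz : ∀ i, h i z = 0) {L : List ℕ}
    {y y' : W} (r : Run E' L y y') : Run (tensorE E h E' t') L (z, y) (z, y') :=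
  r.map (f := fun y => (z, y)) fun e => tensorE_right e (by rw [hz]; exact Nat.zero_le _)

/-- Everything reachable from `(z, y)`, with `z` a sink, has first component `z`. -/
theorem reach_of_sink_pair {z : V} (hz : ∀ i, h i z = 0) {y : W}
    {q : V × W} (r : Reach (tensorE E h E' t') (z, y) q) : q.1 = z ∧ Reach E' y q.2 := by
  induction r with
  | refl => exact ⟨rfl, .refl⟩
  | @tail p q _ e ih =>
    obtain ⟨i, ⟨-, -, l⟩ | ⟨e, hq, -⟩⟩ := e
    · rw [ih.1, hz] at l
      omega
    · exact ⟨hq.trans ih.1, ih.2.tail ⟨i, e⟩⟩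

/-- Everything that reaches `(x, s)`, with `s` a source, has second component `s`. -/
theorem reach_to_source_pair (D : RelCrystal n E' h' t') {s : W} (hs : ∀ i, t' i s = 0) {x : V}
    {q : V × W} (r : Reach (tensorE E h E' t') q (x, s)) : q.2 = s ∧ Reach E q.1 x := by
  induction r using Relation.ReflTransGen.head_induction_on with
  | refl => exact ⟨rfl, .refl⟩
  | @head q p e _ ih =>
    obtain ⟨i, ⟨e, hq, -⟩ | ⟨e, -, -⟩⟩ := e
    · exact ⟨hq.symm.trans ih.1, ih.2.head ⟨i, e⟩⟩
    · have := D.t_step e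
      rw [ih.1, hs] at this
      omega

theorem tensorT_source {x : V} {y : W} (hx : ∀ i, t i x = 0) (hy : ∀ i, t' i y = 0) (i : ℕ) :
    tensorT h t t' i (x, y) = 0 := by simp [tensorT, hx, hy]

theorem tensorH_sink {x : V} {y : W} (hx : ∀ i, h i x = 0) (hy : ∀ i, h' i y = 0) (i : ℕ) :
    tensorH h h' t' i (x, y) = 0 := by simp [tensorH, hx, hy]

theorem tensorH_of_source {x : V} {y : W} (hy : ∀ i, t' i y = 0) (i : ℕ) :
    tensorH h h' t' i (x, y) = h i x + h' i y := by simp [tensorH, hy, add_comm]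

end TensorRun

/-! ### Models of the crystals `K(a)` -/

section Column

/-- The edges of the crystal on sets of naturals, where `i` replaces the element `i`
by `i + 1`. -/
def colE (n i : ℕ) (S S' : Set ℕ) : Prop :=
  (1 ≤ i ∧ i ≤ n) ∧ (i ∈ S ∧ i + 1 ∉ S) ∧ S' = insert (i + 1) (S \ {i})

noncomputable def colH (n i : ℕ) (S : Set ℕ) : ℕ :=
  if (1 ≤ i ∧ i ≤ n) ∧ i ∈ S ∧ i + 1 ∉ S then 1 else 0

noncomputable def colT (n i : ℕ) (S : Set ℕ) : ℕ :=
  if (1 ≤ i ∧ i ≤ n) ∧ i ∉ S ∧ i + 1 ∈ S then 1 else 0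

theorem colE_iff {n i : ℕ} {S S' : Set ℕ} : colE n i S S' ↔
    (1 ≤ i ∧ i ≤ n) ∧ (i ∈ S ∧ i + 1 ∉ S) ∧ (i ∉ S' ∧ i + 1 ∈ S') ∧
      ∀ x, x ≠ i → x ≠ i + 1 → (x ∈ S' ↔ x ∈ S) := by
  unfold colE
  refine and_congr_right fun _ => and_congr_right fun hS => ⟨?_, ?_⟩
  · rintro rfl
    refine ⟨⟨by simp, by simp⟩, fun x h₁ h₂ => by simp [h₁, h₂]⟩
  · rintro ⟨⟨h₁, h₂⟩, h₃⟩
    ext x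
    by_cases hx : x = i
    · subst hx; simp [h₁]
    by_cases hx' : x = i + 1
    · subst hx'; simp [h₂]
    simp [h₃ x hx hx', hx, hx']

theorem colE_rev {n i : ℕ} {S S' : Set ℕ} : colE n i S S' ↔ colE n i S'ᶜ Sᶜ := by
  rw [colE_iff, colE_iff]
  simp only [Set.mem_compl_iff, not_not]
  have : (∀ x, x ≠ i → x ≠ i + 1 → (x ∈ S' ↔ x ∈ S)) ↔
      ∀ x, x ≠ i → x ≠ i + 1 → (x ∉ S ↔ x ∉ S') :=
    forall_congr' fun x => by tauto
  rw [this]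
  tauto

theorem colT_compl {n i : ℕ} {S : Set ℕ} : colT n i Sᶜ = colH n i S := by
  simp [colT, colH]

theorem colH_compl {n i : ℕ} {S : Set ℕ} : colH n i Sᶜ = colT n i S := by
  simp [colT, colH]

theorem colHalf (n : ℕ) : HalfCrystal n (colE n) (colH n) (colT n) where
  color e := e.1
  det e e' := e.2.2.trans e'.2.2.symm
  pos_iff {i u} := by
    unfold colH
    split_ifs with hc
    · exact ⟨fun _ => ⟨_, hc.1, hc.2, rfl⟩, fun _ => one_pos⟩
    · exact ⟨fun hl => absurd hl (lt_irrefl 0), fun ⟨v, e⟩ => absurd ⟨e.1, e.2.1⟩ hc⟩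
  step {i u v} e := by
    rw [colE_iff] at e
    obtain ⟨a, b, c, -⟩ := e
    simp [colH, a, b, c]
  bdd i := ⟨1, fun v => by unfold colH; split_ifs <;> omega⟩
  far {i j u v} hij e := by
    rw [colE_iff] at e
    obtain ⟨-, -, -, d⟩ := e
    unfold Far at hij
    unfold colH
    rw [d j (by omega) (by omega), d (j + 1) (by omega) (by omega)]
  near {i j u v} hij h₁ h₂ e := by
    rw [colE_iff] at e
    obtain ⟨-, b, c, d⟩ := e
    unfold colH colT
    rcases hij with rfl | rfl
    · have := d (i + 1 + 1) (by omega) (by omega)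
      by_cases hx : i + 1 + 1 ∈ u <;> simp_all
    · have := d j (by omega) (by omega)
      by_cases hx : j ∈ u <;> simp_all
  convex {i j u v w} _ _ _ e e' := by
    rw [colE_iff] at e e'
    exact absurd e'.2.1.1 e.2.2.1.1
  square {i j u v w} hij e e' := by
    rw [colE_iff] at e e'
    rcases hij with rfl | rfl
    · exact absurd e'.2.1.1 e.2.1.2
    · exact absurd e.2.1.1 e'.2.1.2
  verma {i j u v w} hij e e' := by
    rw [colE_iff] at e e'
    rcases hij with rfl | rfl
    · exact absurd e'.2.1.1 e.2.1.2
    · exact absurd e.2.1.1 e'.2.1.2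
  comm {i j u v w} hij e e' := by
    rw [colE_iff] at e e'
    obtain ⟨a, b, c, d⟩ := e
    obtain ⟨a', b', c', d'⟩ := e'
    unfold Far at hij
    refine ⟨_, ⟨a', ?_, rfl⟩, ⟨a, ?_, ?_⟩⟩
    · rwa [d j (by omega) (by omega), d (j + 1) (by omega) (by omega)]
    · rwa [d' i (by omega) (by omega), d' (i + 1) (by omega) (by omega)]
    · ext x
      have := d x
      have := d' x
      simp only [Set.mem_insert_iff, Set.mem_sdiff, Set.mem_singleton_iff]
      by_cases h₁ : x = i
      · subst h₁; simp; grind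
      by_cases h₂ : x = i + 1
      · subst h₂; grind
      grind

theorem colCrystal (n : ℕ) : RelCrystal n (colE n) (colH n) (colT n) := by
  refine ⟨colHalf n, ?_⟩
  have := (colHalf n).comap (E' := revE (colE n)) compl compl_injective colE_rev
    fun {i u y} _ => ⟨yᶜ, compl_compl y⟩
  simpa only [colT_compl, colH_compl] using this

theorem run_wStr {n k j : ℕ} (hj : 1 ≤ j) (hk : j + k ≤ n + 1) :
    Run (colE n) (wStr 0 k j) (Set.Ico j (j + k)) (Set.Ico (j + 1) (j + 1 + k)) := by
  have step : ∀ m ≤ k, Run (colE n) ((List.range m).map fun m => 0 + j + k - 1 - m)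
      (Set.Ico j (j + k)) (Set.Ico j (j + k - m) ∪ Set.Ico (j + k - m + 1) (j + 1 + k)) := by
    intro m
    induction m with
    | zero =>
      intro _
      show _ = _
      ext x
      simp only [Set.mem_union, Set.mem_Ico]
      omega
    | succ m ih =>
      intro hm
      rw [List.range_succ, List.map_append, run_append]
      refine ⟨_, ih (by omega), _, colE_iff.2 ⟨?_, ?_, ?_, ?_⟩, rfl⟩
      all_goals simp only [Set.mem_union, Set.mem_Ico]
      · omega
      · omega
      · omega
      · intro x
        omega
  have := step k le_rfl
  unfold wStr
  convert this using 1
  ext x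
  simp only [Set.mem_union, Set.mem_Ico]
  omega

theorem run_SStr {n k : ℕ} (hk : k ≤ n) :
    Run (colE n) (SStr 0 n k) (Set.Ico 1 (1 + k)) (Set.Ico (n - k + 2) (n + 2)) := by
  have step : ∀ m ≤ n - k + 1, Run (colE n) ((List.range m).flatMap fun j => wStr 0 k (j + 1))
      (Set.Ico 1 (1 + k)) (Set.Ico (m + 1) (m + 1 + k)) := by
    intro m
    induction m with
    | zero => intro _; rfl
    | succ m ih =>
      intro hm
      rw [List.range_succ, List.flatMap_append, run_append]
      refine ⟨_, ih (by omega), ?_⟩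
      simpa using run_wStr (n := n) (k := k) (j := m + 1) (by omega) (by omega)
  have := step (n - k + 1) le_rfl
  unfold SStr
  convert this using 2
  omega

end Column

/-- A crystal with source of parameter `a`, in which the string `L` leads from the source
to a sink. -/
structure Model (n : ℕ) (L : List ℕ) (a : ℕ → ℕ) where
  V : Type
  E : ℕ → V → V → Prop
  h : ℕ → V → ℕ
  t : ℕ → V → ℕ
  s : V
  z : V
  crystal : RelCrystal n E h t
  source : ∀ i, t i s = 0
  param : ∀ i, 1 ≤ i → i ≤ n → h i s = a i
  sink : ∀ i, h i z = 0
  run : Run E L s z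

namespace Model

variable {n : ℕ} {L L' : List ℕ} {a b : ℕ → ℕ}

/-- The tensor product of models. -/
def tensor (X : Model n L a) (Y : Model n L' b) : Model n (L ++ L') (fun i => a i + b i) where
  V := X.V × Y.V
  E := tensorE X.E X.h Y.E Y.t
  h := tensorH X.h Y.h Y.t
  t := tensorT X.h X.t Y.t
  s := (X.s, Y.s)
  z := (X.z, Y.z)
  crystal := X.crystal.tensor Y.crystal
  source := tensorT_source X.source Y.source
  param i h₁ h₂ := by rw [tensorH_of_source Y.source, X.param i h₁ h₂, Y.param i h₁ h₂]
  sink := tensorH_sink X.sink Y.sink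
  run := run_append.2 ⟨(X.z, Y.s), X.run.tensor_left X.crystal.out Y.source,
    Y.run.tensor_right X.sink⟩

/-- The trivial crystal. -/
noncomputable def trivial (n : ℕ) : Model n [] (fun _ => 0) where
  V := Set ℕ
  E := colE n
  h := colH n
  t := colT n
  s := ∅
  z := ∅
  crystal := colCrystal n
  source i := by simp [colT]
  param i _ _ := by simp [colH]
  sink i := by simp [colH]
  run := rfl

/-- The fundamental crystals. -/
noncomputable def fundamental {n k : ℕ} (h₁ : 1 ≤ k) (hk : k ≤ n) :
    Model n (SStr 0 n k) (fun i => if i = k then 1 else 0) where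
  V := Set ℕ
  E := colE n
  h := colH n
  t := colT n
  s := Set.Ico 1 (1 + k)
  z := Set.Ico (n - k + 2) (n + 2)
  crystal := colCrystal n
  source i := by
    unfold colT
    rw [if_neg]
    simp only [Set.mem_Ico]
    omega
  param i _ _ := by
    unfold colH
    simp only [Set.mem_Ico]
    split_ifs <;> omega
  sink i := by
    unfold colH
    rw [if_neg]
    simp only [Set.mem_Ico]
    omega
  run := run_SStr hk

/-- Change of the parameter outside the range of colors. -/
def congr (X : Model n L a) (hL : L = L') (hab : ∀ i, 1 ≤ i → i ≤ n → a i = b i) :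
    Model n L' b where
  __ := X
  param i h₁ h₂ := (X.param i h₁ h₂).trans (hab i h₁ h₂)
  run := hL ▸ X.run

/-- Multiples of a fundamental parameter. -/
theorem nonempty_replicate {n k : ℕ} (h₁ : 1 ≤ k) (hk : k ≤ n) (m : ℕ) :
    Nonempty (Model n (List.replicate m (SStr 0 n k)).flatten
      (fun i => if i = k then m else 0)) := by
  induction m with
  | zero => exact ⟨(trivial n).congr rfl (by simp)⟩
  | succ m ih =>
    obtain ⟨X⟩ := ih
    refine ⟨((fundamental h₁ hk).tensor X).congr (by simp [List.replicate_succ]) fun i _ _ => ?_⟩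
    split_ifs <;> omega

/-- Every parameter has a model in which the principal string leads to the sink. -/
theorem nonempty_prinStr (n : ℕ) (a : ℕ → ℕ) : Nonempty (Model n (prinStr 0 n a) a) := by
  have step : ∀ m ≤ n, Nonempty (Model n ((List.range m).flatMap fun km =>
      (List.replicate (a (0 + km + 1)) (SStr 0 n (km + 1))).flatten)
      (fun i => if i ≤ m then a i else 0)) := by
    intro m
    induction m with
    | zero => exact fun _ => ⟨(trivial n).congr rfl fun i h₁ _ => by rw [if_neg (by omega)]⟩
    | succ m ih =>
      intro hm
      obtain ⟨X⟩ := ih (by omega)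
      obtain ⟨Y⟩ := nonempty_replicate (show 1 ≤ m + 1 by omega) hm (a (0 + m + 1))
      refine ⟨(X.tensor Y).congr (by simp [List.range_succ]) fun i _ _ => ?_⟩
      rcases lt_trichotomy i (m + 1) with hi | rfl | hi
      · simp [hi.ne, hi.le, Nat.lt_succ_iff.1 hi]
      · simp
      · simp [hi.ne', hi.not_ge, show ¬ i ≤ m by omega]
  obtain ⟨X⟩ := step n le_rfl
  exact ⟨X.congr rfl fun i _ h₂ => if_pos h₂⟩

end Model

/-! ### Principal vertices and intervals -/

section Principal

variable {n : ℕ} {V : Type} {E : ℕ → V → V → Prop} {h t : ℕ → V → ℕ} {s : V}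
  {a b c : ℕ → ℕ}

theorem Model.run_sink {L L' : List ℕ} (X : Model n L a) (Y : Model n L' b)
    (hab : ∀ i, 1 ≤ i → i ≤ n → a i = b i) : Run Y.E L Y.s Y.z := by
  obtain ⟨M, H, m⟩ := exists_matching X.crystal Y.crystal X.source Y.source
    fun i h₁ h₂ => by rw [X.param i h₁ h₂, Y.param i h₁ h₂, hab i h₁ h₂]
  obtain ⟨v, r, mv⟩ := H.run_fwd m X.run
  have hv : ∀ i, Y.h i v = 0 := fun i => by rw [← H.length mv, X.sink]
  have := Y.crystal.eq_of_reach_of_sink Y.sink (Y.crystal.reach_sink hv Y.run.reach r.reach)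
  rwa [this] at r

/-- The factorization of `K(c)` at the principal vertices with coordinates `a ≤ b`. -/
theorem exists_factorization (C : RelCrystal n E h t) (hs : ∀ i, t i s = 0)
    (hc : ∀ i, 1 ≤ i → i ≤ n → h i s = c i) (hab : ∀ i, 1 ≤ i → i ≤ n → a i ≤ b i)
    (hbc : ∀ i, 1 ≤ i → i ≤ n → b i ≤ c i) :
    ∃ (X : Model n (prinStr 0 n a) a)
      (Y : Model n (prinStr 0 n fun i => b i - a i) fun i => b i - a i)
      (Z : Model n (prinStr 0 n fun i => c i - b i) fun i => c i - b i)
      (M : V → (X.V × Y.V) × Z.V → Prop) (p q : V),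
      Matching E ((X.tensor Y).tensor Z).E h ((X.tensor Y).tensor Z).h M ∧
      M p ((X.z, Y.s), Z.s) ∧ M q ((X.z, Y.z), Z.s) ∧
      Run E (prinStr 0 n a) s p ∧ Run E (prinStr 0 n b) s q ∧
      Run E (prinStr 0 n fun i => b i - a i) p q := by
  obtain ⟨X⟩ := Model.nonempty_prinStr n a
  obtain ⟨Y⟩ := Model.nonempty_prinStr n fun i => b i - a i
  obtain ⟨Z⟩ := Model.nonempty_prinStr n fun i => c i - b i
  obtain ⟨X'⟩ := Model.nonempty_prinStr n b
  obtain ⟨M, H, m⟩ := exists_matching C ((X.tensor Y).tensor Z).crystal hs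
    ((X.tensor Y).tensor Z).source fun i h₁ h₂ => by
      rw [hc i h₁ h₂, ((X.tensor Y).tensor Z).param i h₁ h₂]
      have := hab i h₁ h₂
      have := hbc i h₁ h₂
      omega
  have rX : Run ((X.tensor Y).tensor Z).E (prinStr 0 n a) ((X.s, Y.s), Z.s) ((X.z, Y.s), Z.s) :=
    (X.run.tensor_left X.crystal.out Y.source).tensor_left (X.tensor Y).crystal.out Z.source
  have rY : Run ((X.tensor Y).tensor Z).E (prinStr 0 n fun i => b i - a i)
      ((X.z, Y.s), Z.s) ((X.z, Y.z), Z.s) :=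
    (Y.run.tensor_right X.sink).tensor_left (X.tensor Y).crystal.out Z.source
  have rXY : Run ((X.tensor Y).tensor Z).E (prinStr 0 n b) ((X.s, Y.s), Z.s) ((X.z, Y.z), Z.s) :=
    (X'.run_sink (X.tensor Y) fun i h₁ h₂ => by
      have := hab i h₁ h₂
      omega).tensor_left (X.tensor Y).crystal.out Z.source
  obtain ⟨p, rp, mp⟩ := H.run_bwd m rX
  obtain ⟨q, rq, mq⟩ := H.run_bwd m rXY
  obtain ⟨q', rq', mq'⟩ := H.run_bwd mp rY
  obtain rfl := H.inj mq mq'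
  exact ⟨X, Y, Z, M, p, q, H, mp, mq, rp, rq, rq'⟩

theorem tensor_middle_iff {L L' L'' : List ℕ} {a b c : ℕ → ℕ} (X : Model n L a) (Y : Model n L' b)
    (Z : Model n L'' c) {i : ℕ} {y y' : Y.V} :
    ((X.tensor Y).tensor Z).E i ((X.z, y), Z.s) ((X.z, y'), Z.s) ↔ Y.E i y y' := by
  constructor
  · rintro (⟨⟨-, -, l⟩ | ⟨e, -, -⟩, -, -⟩ | ⟨e, -, -⟩)
    · have := X.sink i
      simp only at l
      omega
    · exact e
    · have := Z.crystal.t_step e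
      simp only at this
      omega
  · intro e
    have hy : (X.tensor Y).E i (X.z, y) (X.z, y') :=
      tensorE_right e (by rw [X.sink]; exact Nat.zero_le _)
    exact tensorE_left hy (by rw [Z.source]; exact (X.tensor Y).crystal.out.pos hy)

/-- The vertices on directed paths from `p` to `q`. -/
abbrev Between (E : ℕ → V → V → Prop) (p q : V) : Type := {w : V // Reach E p w ∧ Reach E w q}

/-- The interval between two principal vertices embeds into a model as a union of components. -/
theorem exists_interval_embedding (C : RelCrystal n E h t) (hs : ∀ i, t i s = 0)
    (hc : ∀ i, 1 ≤ i → i ≤ n → h i s = c i) (hab : ∀ i, 1 ≤ i → i ≤ n → a i ≤ b i)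
    (hbc : ∀ i, 1 ≤ i → i ≤ n → b i ≤ c i) {p q : V} (hp : Run E (prinStr 0 n a) s p)
    (hq : Run E (prinStr 0 n b) s q) :
    ∃ (Y : Model n (prinStr 0 n fun i => b i - a i) fun i => b i - a i) (f : Between E p q → Y.V),
      Function.Injective f ∧ (∀ {i} {u v : Between E p q}, E i u.1 v.1 ↔ Y.E i (f u) (f v)) ∧
      (∀ {i u y}, Y.E i (f u) y → ∃ v, f v = y) ∧ (∀ {i u y}, Y.E i y (f u) → ∃ v, f v = y) ∧
      ∃ v : Between E p q, v.1 = p ∧ f v = Y.s := by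
  obtain ⟨X, Y, Z, M, p', q', H, mp, mq, rp, rq, -⟩ := exists_factorization C hs hc hab hbc
  obtain rfl := Run.det C.out hp rp
  obtain rfl := Run.det C.out hq rq
  have lift : ∀ {y y'}, Reach Y.E y y' →
      Reach ((X.tensor Y).tensor Z).E ((X.z, y), Z.s) ((X.z, y'), Z.s) := by
    intro y y' r
    induction r with
    | refl => exact .refl
    | tail _ e ih =>
      obtain ⟨i, e⟩ := e
      exact ih.tail ⟨i, (tensor_middle_iff X Y Z).2 e⟩
  have mem : ∀ {w y}, M w ((X.z, y), Z.s) → Reach Y.E Y.s y → Reach E p w ∧ Reach E w q := by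
    intro w y mw r
    obtain ⟨w', r', mw'⟩ := H.reach_bwd mp (lift r)
    obtain rfl := H.inj mw mw'
    obtain ⟨q', rq', mq'⟩ := H.reach_bwd mw (lift (Y.crystal.reach_sink Y.sink r Y.run.reach))
    obtain rfl := H.inj mq mq'
    exact ⟨r', rq'⟩
  have ex : ∀ w : Between E p q, ∃ y, M w.1 ((X.z, y), Z.s) ∧ Reach Y.E Y.s y := by
    rintro ⟨w, r₁, r₂⟩
    obtain ⟨w', r₁', mw⟩ := H.reach_fwd mp r₁
    obtain ⟨q', r₂', mq'⟩ := H.reach_fwd mw r₂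
    obtain rfl := H.uniq mq mq'
    have h₁ := (reach_to_source_pair Z.crystal Z.source r₂').1
    obtain ⟨⟨x, y⟩, z⟩ := w'
    obtain rfl : z = Z.s := h₁
    obtain ⟨h₂, h₃⟩ := reach_of_sink_pair X.sink (reach_to_source_pair Z.crystal Z.source r₁').2
    obtain rfl : x = X.z := h₂
    exact ⟨y, mw, h₃⟩
  choose f hf hr using ex
  have val : ∀ {w y}, M w ((X.z, y), Z.s) → Reach Y.E Y.s y → ∃ v : Between E p q,
      v.1 = w ∧ f v = y := by
    intro w y mw r
    refine ⟨⟨w, mem mw r⟩, rfl, ?_⟩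
    exact congrArg (fun x : (X.V × Y.V) × Z.V => x.1.2) (H.uniq (hf ⟨w, mem mw r⟩) mw)
  refine ⟨Y, f, fun u v huv => ?_, fun {i u v} => ⟨fun e => ?_, fun e => ?_⟩, fun {i u y} e => ?_,
    fun {i u y} e => ?_, ?_⟩
  · have hu := hf u
    rw [huv] at hu
    exact Subtype.ext (H.inj hu (hf v))
  · obtain ⟨v', e', mv⟩ := H.fwd (hf u) e
    rw [H.uniq mv (hf v)] at e'
    exact (tensor_middle_iff X Y Z).1 e'
  · obtain ⟨v', e', mv⟩ := H.bwd (hf u) ((tensor_middle_iff X Y Z).2 e)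
    rwa [H.inj mv (hf v)] at e'
  · obtain ⟨v', e', mv⟩ := H.bwd (hf u) ((tensor_middle_iff X Y Z).2 e)
    obtain ⟨v, -, hv⟩ := val mv ((hr u).tail ⟨i, e⟩)
    exact ⟨v, hv⟩
  · have r := Y.crystal.reach_of_source Y.source (hr u) (.single ⟨i, e⟩)
    obtain ⟨v', -, mv⟩ := H.reach_bwd mp (lift r)
    obtain ⟨v, -, hv⟩ := val mv r
    exact ⟨v, hv⟩
  · exact val mp .refl

theorem Run.between {p q : V} {L : List ℕ} {u w : V} (r : Run E L u w)
    (hu : Reach E p u ∧ Reach E u q)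
    (hw : Reach E p w ∧ Reach E w q) :
    Run (fun i (x y : Between E p q) => E i x.1 y.1) L ⟨u, hu⟩ ⟨w, hw⟩ := by
  induction L generalizing u with
  | nil => exact Subtype.ext r
  | cons i L ih =>
    obtain ⟨x, e, r⟩ := r
    exact ⟨⟨x, hu.1.tail ⟨i, e⟩, r.reach.trans hw.2⟩, e, ih r _⟩

/-- Inside the interval from `v[a]`, the principal vertex with coordinates `b - a` is `v[b]`. -/
theorem run_between_iff (C : RelCrystal n E h t) (hs : ∀ i, t i s = 0)
    (hc : ∀ i, 1 ≤ i → i ≤ n → h i s = c i) (hab : ∀ i, 1 ≤ i → i ≤ n → a i ≤ b i)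
    (hbc : ∀ i, 1 ≤ i → i ≤ n → b i ≤ c i) {p q : V} (hp : Run E (prinStr 0 n a) s p)
    (v w : Between E p q) (hv : v.1 = p) :
    Run (fun i (x y : Between E p q) => E i x.1 y.1) (prinStr 0 n fun i => b i - a i) v w ↔
      Run E (prinStr 0 n b) s w.1 := by
  obtain ⟨-, -, -, -, p', x, -, -, -, rp, rx, r⟩ := exists_factorization C hs hc hab hbc
  obtain rfl := Run.det C.out hp rp
  obtain ⟨v, hv'⟩ := v
  obtain rfl : v = p := hv
  constructor
  · intro rw
    have rw' : Run E _ v w.1 := rw.map (f := Subtype.val) fun e => e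
    rwa [← Run.det C.out r rw']
  · intro rw
    obtain rfl := Run.det C.out rx rw
    exact r.between _ w.2

end Principal

/-! ### Colored graphs as edge relations -/

namespace PreGraph

/-- The edge relation of a graph. -/
def edge (K : PreGraph) (i : ℕ) (u v : K.V) : Prop := K.F i u = some v

end PreGraph

theorem optIter_add {V : Type} (f : V → Option V) (j k : ℕ) (v : V) :
    optIter f (j + k) v = (optIter f j v).bind (optIter f k) := by
  induction j generalizing v with
  | zero => simp [optIter]
  | succ j ih =>
    rw [Nat.succ_add]
    simp only [optIter, Option.bind_assoc]
    cases f v with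
    | none => rfl
    | some w => exact ih w

theorem optIter_succ_eq_some {V : Type} {f : V → Option V} {k : ℕ} {u v : V} :
    optIter f (k + 1) u = some v ↔ ∃ w, optIter f k u = some w ∧ f w = some v := by
  have h₁ : optIter f 1 = f := by
    funext x
    simp only [optIter]
    cases f x <;> rfl
  rw [optIter_add, h₁, Option.bind_eq_some_iff]

theorem optIter_lt_card {V : Type} [Finite V] {f : V → Option V}
    (hf : ∀ v k, 0 < k → optIter f k v ≠ some v) {k : ℕ} {u v : V}
    (huv : optIter f k u = some v) : k < Nat.card V := by
  have ex : ∀ j : Fin (k + 1), ∃ w, optIter f j u = some w := by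
    intro j
    have hk : optIter f (j + (k - j)) u = some v := by
      rw [Nat.add_sub_cancel' (by omega), huv]
    rw [optIter_add, Option.bind_eq_some_iff] at hk
    exact ⟨_, hk.choose_spec.1⟩
  choose g hg using ex
  have lt : ∀ j j' : Fin (k + 1), j < j' → g j ≠ g j' := by
    intro j j' hj heq
    have h₁ := hg j'
    rw [← heq, show (j' : ℕ) = j + (j' - j) by omega, optIter_add, hg j] at h₁
    exact hf (g j) (j' - j) (by omega) h₁
  have inj : Function.Injective g := by
    intro j j' heq
    rcases lt_trichotomy j j' with hj | hj | hj
    · exact absurd heq (lt j j' hj)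
    · exact hj
    · exact absurd heq.symm (lt j' j hj)
  have := Nat.card_le_card_of_injective g inj
  rw [Nat.card_fin] at this
  omega

theorem le_sSup_iff_of_lower {A : Set ℕ} (h0 : 0 ∈ A) (hdown : ∀ k, k + 1 ∈ A → k ∈ A) {B : ℕ}
    (hB : ∀ k ∈ A, k ≤ B) {k : ℕ} : k ≤ sSup A ↔ k ∈ A := by
  have bdd : BddAbove A := ⟨B, hB⟩
  refine ⟨fun hk => ?_, fun hk => le_csSup bdd hk⟩
  exact Nat.decreasingInduction (motive := fun m _ => m ∈ A) (fun m _ hm => hdown m hm)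
    (Nat.sSup_mem ⟨0, h0⟩ bdd) hk

namespace IsColored

variable {K : PreGraph} {S : Set ℕ}

theorem le_h_iff (hK : IsColored K S) {i k : ℕ} {v : K.V} :
    k ≤ K.h i v ↔ (optIter (K.F i) k v).isSome = true := by
  have := hK.1
  refine le_sSup_iff_of_lower (A := {k | (optIter (K.F i) k v).isSome = true}) rfl
    (fun k hk => ?_) (B := Nat.card K.V) fun k hk => ?_
  · obtain ⟨w, hw⟩ := Option.isSome_iff_exists.1 hk
    obtain ⟨x, hx, -⟩ := optIter_succ_eq_some.1 hw
    exact Option.isSome_iff_exists.2 ⟨x, hx⟩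
  · obtain ⟨w, hw⟩ := Option.isSome_iff_exists.1 hk
    exact (optIter_lt_card (hK.2.2.2 i) hw).le

theorem le_t_iff (hK : IsColored K S) {i k : ℕ} {v : K.V} :
    k ≤ K.t i v ↔ ∃ u, optIter (K.F i) k u = some v := by
  have := hK.1
  refine le_sSup_iff_of_lower (A := {k | ∃ u, optIter (K.F i) k u = some v}) ⟨v, rfl⟩
    (fun k hk => ?_) (B := Nat.card K.V) fun k hk => ?_
  · obtain ⟨u, hu⟩ := hk
    obtain ⟨w, -, hw⟩ := Option.bind_eq_some_iff.1 hu
    exact ⟨w, hw⟩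
  · obtain ⟨w, hw⟩ := hk
    exact (optIter_lt_card (hK.2.2.2 i) hw).le

theorem h_pos_iff (hK : IsColored K S) {i : ℕ} {v : K.V} : 0 < K.h i v ↔ ∃ w, K.edge i v w := by
  rw [← Nat.succ_le_iff, hK.le_h_iff, Option.isSome_iff_exists]
  simp [optIter, PreGraph.edge]

theorem t_pos_iff (hK : IsColored K S) {i : ℕ} {v : K.V} : 0 < K.t i v ↔ ∃ u, K.edge i u v := by
  rw [← Nat.succ_le_iff, hK.le_t_iff]
  simp [optIter, PreGraph.edge]

theorem h_step (hK : IsColored K S) {i : ℕ} {u v : K.V} (e : K.edge i u v) :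
    K.h i u = K.h i v + 1 := by
  have e' : K.F i u = some v := e
  have key : ∀ k, k + 1 ≤ K.h i u ↔ k ≤ K.h i v := fun k => by
    rw [hK.le_h_iff, hK.le_h_iff, optIter, e', Option.bind_some]
  have h₁ := key (K.h i v)
  have h₂ := key (K.h i v + 1)
  omega

theorem t_step (hK : IsColored K S) {i : ℕ} {u v : K.V} (e : K.edge i u v) :
    K.t i v = K.t i u + 1 := by
  have key : ∀ k, k + 1 ≤ K.t i v ↔ k ≤ K.t i u := fun k => by
    rw [hK.le_t_iff, hK.le_t_iff]
    refine exists_congr fun x => ?_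
    rw [optIter_succ_eq_some]
    constructor
    · rintro ⟨w, hw, hwv⟩
      rwa [← hK.2.2.1 i w u v hwv e]
    · exact fun hx => ⟨u, hx, e⟩
  have h₁ := key (K.t i u)
  have h₂ := key (K.t i u + 1)
  omega

theorem Finv_eq_some_iff (hK : IsColored K S) {i : ℕ} {u v : K.V} :
    K.Finv i v = some u ↔ K.edge i u v := by
  unfold PreGraph.Finv
  split_ifs with hx
  · rw [Option.some_inj]
    constructor
    · rintro rfl
      exact hx.choose_spec
    · exact fun e => hK.2.2.1 i _ _ v hx.choose_spec e
  · simp only [false_iff]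
    exact fun e => hx ⟨u, e⟩

end IsColored

/-- The edge relation of an `A_n`-crystal satisfies the relational axioms. -/
theorem IsACrystal.relCrystal {n : ℕ} {K : PreGraph} (hK : IsACrystal n K) :
    RelCrystal n K.edge K.h K.t := by
  obtain ⟨hC, -, h2, h34, h5⟩ := hK
  have := hC.1
  have color : ∀ {i u v}, K.edge i u v → 1 ≤ i ∧ i ≤ n := by
    intro i u v e
    by_contra hi
    have := hC.2.1 i hi u
    unfold PreGraph.edge at e
    simp [this] at e
  have near : ∀ {i j u v}, Neighb i j → 1 ≤ j → j ≤ n → K.edge i u v →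
      (K.h j v = K.h j u + 1 ∧ K.t j v = K.t j u) ∨
      (K.h j v = K.h j u ∧ K.t j u = K.t j v + 1) := by
    intro i j u v hij h₁ h₂ e
    have := (h2 i (color e) j ⟨h₁, h₂⟩ hij.ne).1 u v e
    rw [if_pos hij] at this
    omega
  have far : ∀ {i j u v}, Far i j → K.edge i u v → K.h j v = K.h j u ∧ K.t j v = K.t j u := by
    intro i j u v hij e
    by_cases hj : 1 ≤ j ∧ j ≤ n
    · have := (h2 i (color e) j hj (by unfold Far at hij; omega)).1 u v e
      rw [if_neg (by unfold Far at hij; unfold Neighb; omega)] at this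
      omega
    · have h₁ : ∀ v, K.h j v = 0 := fun v => by
        by_contra h0
        obtain ⟨w, hw⟩ := hC.h_pos_iff.1 (Nat.pos_of_ne_zero h0)
        exact hj (color hw)
      have h₂ : ∀ v, K.t j v = 0 := fun v => by
        by_contra h0
        obtain ⟨w, hw⟩ := hC.t_pos_iff.1 (Nat.pos_of_ne_zero h0)
        exact hj (color hw)
      rw [h₁, h₁, h₂, h₂]
      exact ⟨rfl, rfl⟩
  have convex : ∀ {i j u v w}, Neighb i j → 1 ≤ j → j ≤ n → K.edge i u v → K.edge i v w →
      2 * K.h j v ≤ K.h j u + K.h j w := fun hij h₁ h₂ e e' =>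
    (h2 _ (color e) _ ⟨h₁, h₂⟩ hij.ne).2 _ _ _ e e'
  have bdd : ∀ g : K.V → ℕ, ∃ B, ∀ v, g v ≤ B := fun g => by
    obtain ⟨B, hB⟩ := (Set.finite_range g).bddAbove
    exact ⟨B, fun v => hB ⟨v, rfl⟩⟩
  constructor
  · refine ⟨color, fun e e' => ?_, hC.h_pos_iff, hC.h_step, fun i => bdd _,
      fun hij e => (far hij e).1, near, ?_, ?_, ?_, ?_⟩
    · exact Option.some_inj.1 (Eq.trans (Eq.symm e) e')
    · intro i j u v w hij h₁ h₂ e e' l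
      have := convex hij h₁ h₂ e e'
      have := near hij h₁ h₂ e'
      omega
    · intro i j u v w hij e e' l
      obtain ⟨l', x, hx⟩ := (h34 i (color e) j (color e') hij).1.1 u v w e e' l
      exact ⟨by omega, x, hx⟩
    · intro i j u v w hij e e' l l'
      obtain ⟨x, h₁, h₂⟩ := (h34 i (color e) j (color e') hij).2.1 u v w e e' (by omega) (by omega)
      unfold PreGraph.edge at e e' ⊢
      rw [e, Option.bind_some] at h₁
      rw [e', Option.bind_some] at h₂
      simp only [Option.bind_eq_some_iff] at h₁ h₂
      obtain ⟨v₃, ⟨v₂, a, b⟩, c⟩ := h₁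
      obtain ⟨w₃, ⟨w₂, a', b'⟩, c'⟩ := h₂
      exact ⟨v₂, v₃, w₂, w₃, x, a, b, c, a', b', c'⟩
    · intro i j u v w hij e e'
      obtain ⟨x, h₁, h₂⟩ := h5 i (color e) j (color e') hij (K.F i) (by simp) (K.F j) (by simp) u
        (Option.isSome_iff_exists.2 ⟨v, e⟩) (Option.isSome_iff_exists.2 ⟨w, e'⟩)
      unfold PreGraph.edge at e e' ⊢
      rw [e, Option.bind_some] at h₁
      rw [e', Option.bind_some] at h₂
      exact ⟨x, h₁, h₂⟩
  · refine ⟨color, fun e e' => hC.2.2.1 _ _ _ _ e e', hC.t_pos_iff, hC.t_step, fun i => bdd _,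
      fun hij e => (far hij e).2.symm, ?_, ?_, ?_, ?_, ?_⟩
    · intro i j u v hij h₁ h₂ e
      have := near hij h₁ h₂ e
      omega
    · intro i j u v w hij h₁ h₂ e e' l
      have := convex hij h₁ h₂ e' e
      have := near hij h₁ h₂ e
      have := near hij h₁ h₂ e'
      omega
    · intro i j u v w hij e e' l
      have r := color e
      have r' := color e'
      have hn := near hij r'.1 r'.2 e
      have hn' := near hij.symm r.1 r.2 e'
      obtain ⟨l', x, hx⟩ := (h34 i r j r' hij).1.2 v w u e e' (by omega)
      exact ⟨by omega, x, hx⟩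
    · intro i j u v w hij e e' l l'
      have r := color e
      have r' := color e'
      have hn := near hij r'.1 r'.2 e
      have hn' := near hij.symm r.1 r.2 e'
      obtain ⟨x, h₁, h₂⟩ := (h34 i r j r' hij).2.2 v w u e e' (by omega) (by omega)
      rw [hC.Finv_eq_some_iff.2 e, Option.bind_some] at h₁
      rw [hC.Finv_eq_some_iff.2 e', Option.bind_some] at h₂
      simp only [Option.bind_eq_some_iff, hC.Finv_eq_some_iff] at h₁ h₂
      obtain ⟨v₃, ⟨v₂, a, b⟩, c⟩ := h₁
      obtain ⟨w₃, ⟨w₂, a', b'⟩, c'⟩ := h₂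
      exact ⟨v₂, v₃, w₂, w₃, x, a, b, c, a', b', c'⟩
    · intro i j u v w hij e e'
      have i₁ := hC.Finv_eq_some_iff.2 e
      have i₂ := hC.Finv_eq_some_iff.2 e'
      obtain ⟨x, h₁, h₂⟩ := h5 i (color e) j (color e') hij (K.Finv i) (by simp) (K.Finv j)
        (by simp) u (Option.isSome_iff_exists.2 ⟨v, i₁⟩) (Option.isSome_iff_exists.2 ⟨w, i₂⟩)
      rw [i₁, Option.bind_some] at h₁
      rw [i₂, Option.bind_some] at h₂
      exact ⟨x, hC.Finv_eq_some_iff.1 h₁, hC.Finv_eq_some_iff.1 h₂⟩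

namespace RelCrystal

variable {n : ℕ} {G : PreGraph} {h t : ℕ → G.V → ℕ}

theorem isSome_optIter_iff (C : RelCrystal n G.edge h t) {i k : ℕ} {v : G.V} :
    (optIter (G.F i) k v).isSome = true ↔ k ≤ h i v := by
  induction k generalizing v with
  | zero => simp [optIter]
  | succ k ih =>
    rcases hv : G.F i v with _ | w
    · have h0 : h i v = 0 := by
        by_contra h0
        obtain ⟨w, hw⟩ := C.out.pos_iff.1 (Nat.pos_of_ne_zero h0)
        unfold PreGraph.edge at hw
        simp [hv] at hw
      simp [optIter, hv, h0]
    · rw [optIter, hv, Option.bind_some, ih, C.out.step (show G.edge i v w from hv)]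
      omega

theorem exists_optIter_iff (C : RelCrystal n G.edge h t) {i k : ℕ} {v : G.V} :
    (∃ u, optIter (G.F i) k u = some v) ↔ k ≤ t i v := by
  induction k generalizing v with
  | zero => simp [optIter]
  | succ k ih =>
    simp only [optIter_succ_eq_some]
    constructor
    · rintro ⟨u, w, hu, e⟩
      have := ih.1 ⟨u, hu⟩
      have := C.t_step (show G.edge i w v from e)
      omega
    · intro hk
      obtain ⟨w, e⟩ := C.inn.pos_iff.1 (show 0 < t i v by omega)
      have := C.t_step (show G.edge i w v from e)
      obtain ⟨u, hu⟩ := (ih (v := w)).2 (by omega)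
      exact ⟨u, w, hu, e⟩

theorem h_eq (C : RelCrystal n G.edge h t) : G.h = h := by
  funext i v
  unfold PreGraph.h
  simp only [C.isSome_optIter_iff]
  exact csSup_Iic

theorem t_eq (C : RelCrystal n G.edge h t) : G.t = t := by
  funext i v
  unfold PreGraph.t
  simp only [C.exists_optIter_iff]
  exact csSup_Iic

theorem h_optIter (C : RelCrystal n G.edge h t) {i k : ℕ} {u v : G.V}
    (huv : optIter (G.F i) k u = some v) : h i u = h i v + k := by
  induction k generalizing u with
  | zero => rw [Option.some_inj.1 huv, add_zero]
  | succ k ih =>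
    obtain ⟨w, e, hw⟩ := Option.bind_eq_some_iff.1 huv
    rw [C.out.step (show G.edge i u w from e), ih hw, add_assoc]

theorem isColored (C : RelCrystal n G.edge h t) [Finite G.V] : IsColored G (Set.Icc 1 n) := by
  refine ⟨inferInstance, fun i hi v => ?_, fun i u u' v e e' => C.inj e e', fun i v k hk hv => ?_⟩
  · by_contra hv
    obtain ⟨w, hw⟩ := Option.ne_none_iff_exists'.1 hv
    exact hi (C.out.color (show G.edge i v w from hw))
  · have := C.h_optIter hv
    omega

/-- A finite connected graph satisfying the relational axioms is an `A_n`-crystal. -/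
theorem isACrystal (C : RelCrystal n G.edge h t) [Finite G.V] (hconn : G.Connected) :
    IsACrystal n G := by
  have hC := C.isColored
  obtain rfl := C.h_eq
  obtain rfl := C.t_eq
  refine ⟨hC, hconn, fun i hi j hj hij => ?_, fun i hi j hj hij => ⟨?_, ?_⟩,
    fun i hi j hj hij => ?_⟩
  · rcases eq_or_neighb_or_far i j with rfl | hij | hij'
    · exact absurd rfl hij
    · refine ⟨fun u v e => ?_, fun u v w e e' => ?_⟩
      · have := C.out.near hij hj.1 hj.2 e
        rw [if_pos hij]
        omega
      · have := C.out.near hij hj.1 hj.2 e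
        have := C.out.near hij hj.1 hj.2 e'
        have := C.out.convex hij hj.1 hj.2 e e'
        omega
    · refine ⟨fun u v e => ?_, fun u v w e e' => ?_⟩
      · have := C.out.far hij' e
        have := C.t_far hij' e
        rw [if_neg (by unfold Far at hij'; unfold Neighb; omega)]
        omega
      · have := C.out.far hij' e
        have := C.out.far hij' e'
        omega
  · refine ⟨fun u v v' e e' l => ?_, fun u u' v e e' l => ?_⟩
    · obtain ⟨l', hx⟩ := C.out.square hij e e' l
      exact ⟨by omega, hx⟩
    · have := C.out.near hij hj.1 hj.2 e
      have := C.out.near hij.symm hi.1 hi.2 e'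
      obtain ⟨l', hx⟩ := C.inn.square (u := v) (v := u) (w := u') hij e e' (by omega)
      exact ⟨by omega, hx⟩
  · refine ⟨fun u v v' e e' l l' => ?_, fun u u' v e e' l l' => ?_⟩
    · obtain ⟨v₂, v₃, w₂, w₃, x, a₁, a₂, a₃, b₁, b₂, b₃⟩ :=
        C.out.verma hij e e' (by omega) (by omega)
      unfold PreGraph.edge at a₁ a₂ a₃ b₁ b₂ b₃
      exact ⟨x, by simp [e, a₁, a₂, a₃], by simp [e', b₁, b₂, b₃]⟩
    · have := C.out.near hij hj.1 hj.2 e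
      have := C.out.near hij.symm hi.1 hi.2 e'
      obtain ⟨v₂, v₃, w₂, w₃, x, a₁, a₂, a₃, b₁, b₂, b₃⟩ :=
        C.inn.verma (u := v) (v := u) (w := u') hij e e' (by omega) (by omega)
      refine ⟨x, ?_, ?_⟩
      · simp only [Option.bind_eq_some_iff, hC.Finv_eq_some_iff]
        exact ⟨v₃, ⟨v₂, ⟨u, e, a₁⟩, a₂⟩, a₃⟩
      · simp only [Option.bind_eq_some_iff, hC.Finv_eq_some_iff]
        exact ⟨w₃, ⟨w₂, ⟨u', e', b₁⟩, b₂⟩, b₃⟩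
  · have mixed : ∀ {i j : ℕ} {v x y : G.V}, Far i j → G.edge i v x → G.edge j y v →
        ∃ w, G.edge j w x ∧ G.edge i y w := by
      intro i j v x y hij e e'
      have hp := C.out.pos e
      rw [C.out.far hij.symm e'] at hp
      obtain ⟨w, hw⟩ := C.out.pos_iff.1 hp
      obtain ⟨x', a, b⟩ := C.out.comm hij hw e'
      obtain rfl := C.out.det e b
      exact ⟨w, a, hw⟩
    have toF : ∀ {i : ℕ} {u v : G.V}, G.F i u = some v ↔ G.edge i u v := Iff.rfl
    rintro Fi (rfl | rfl) Fj (rfl | rfl) v h₁ h₂ <;>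
      obtain ⟨x, hx⟩ := Option.isSome_iff_exists.1 h₁ <;>
      obtain ⟨y, hy⟩ := Option.isSome_iff_exists.1 h₂ <;>
      rw [hx, hy, Option.bind_some, Option.bind_some] <;>
      simp only [hC.Finv_eq_some_iff, toF] at hx hy ⊢
    · exact C.out.comm hij hx hy
    · exact mixed hij hx hy
    · obtain ⟨w, a, b⟩ := mixed hij.symm hy hx
      exact ⟨w, b, a⟩
    · exact C.inn.comm (u := v) hij hx hy

end RelCrystal

theorem applyStr_eq_some_iff {K : PreGraph} {L : List ℕ} {u v : K.V} :
    applyStr K L u = some v ↔ Run K.edge L u v := by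
  induction L generalizing u with
  | nil => exact Option.some_inj
  | cons i L ih =>
    simp only [applyStr, Option.bind_eq_some_iff, Run, ih]
    rfl

theorem isPrin_iff {K : PreGraph} {n : ℕ} {a : ℕ → ℕ} {s p : K.V} :
    IsPrin K 0 n s a p ↔ Run K.edge (prinStr 0 n a) s p :=
  applyStr_eq_some_iff

theorem interval_edge_iff {K : PreGraph} {p q : K.V} {i : ℕ} {u v : (K.interval p q).V} :
    (K.interval p q).edge i u v ↔ K.edge i u.1 v.1 := by
  unfold PreGraph.edge
  constructor
  · intro e
    obtain ⟨w, hw, e⟩ := Option.pbind_eq_some_iff.1 e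
    split_ifs at e with hc
    have : (⟨w, hc⟩ : (K.interval p q).V) = v := Option.some_inj.1 e
    rw [← this]
    exact hw
  · exact fun e => Option.pbind_eq_some_iff.2 ⟨v.1, e, dif_pos v.2⟩

theorem interval_connected (K : PreGraph) (p q : K.V) : (K.interval p q).Connected := by
  have from_p : ∀ {w : K.V} (hw : Reach K.edge p w) (hp : Reach K.edge p q) (hq : Reach K.edge w q),
      Relation.ReflTransGen (K.interval p q).Step ⟨p, .refl, hp⟩ ⟨w, hw, hq⟩ := by
    intro w hw hp
    induction hw with
    | refl => intro _; exact .refl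
    | @tail x y hx e ih =>
      intro hq
      refine (ih (hq.head e)).tail ?_
      obtain ⟨i, e⟩ := e
      exact ⟨i, Or.inl (interval_edge_iff.2 e)⟩
  have symm : ∀ {u v}, Relation.ReflTransGen (K.interval p q).Step u v →
      Relation.ReflTransGen (K.interval p q).Step v u := by
    intro u v r
    induction r with
    | refl => exact .refl
    | tail _ e ih =>
      obtain ⟨i, e⟩ := e
      exact ih.head ⟨i, e.symm⟩
  intro u v
  have hp : Reach K.edge p q := u.2.1.trans u.2.2
  exact (symm (from_p u.2.1 hp u.2.2)).trans (from_p v.2.1 hp v.2.2)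

/-- For `0 ≤ c' ≤ c'' ≤ c`, the interval `K(c' : c'')` of `K(c)` from
`v[c']` to `v[c'']` is (isomorphic to) the `A_n`-crystal `K(c'' - c')`, and its principal
lattice corresponds exactly to the set `{v[a] : c' ≤ a ≤ c''}` of principal vertices of `K`. -/
theorem interval_is_crystal
    (n : ℕ) (K : PreGraph) (hK : IsACrystal n K)
    (s : K.V) (hs : IsSource K s)
    (c : ℕ → ℕ) (hc : ∀ i, 1 ≤ i → i ≤ n → K.h i s = c i)
    (c' c'' : ℕ → ℕ)
    (h1 : ∀ i, 1 ≤ i → i ≤ n → c' i ≤ c'' i)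
    (h2 : ∀ i, 1 ≤ i → i ≤ n → c'' i ≤ c i)
    (p' p'' : K.V) (hp' : IsPrin K 0 n s c' p') (hp'' : IsPrin K 0 n s c'' p'') :
    IsCrystalOn (K.interval p' p'') (Set.Icc 1 n) ∧
    ∃ s0 : (K.interval p' p'').V, IsSource (K.interval p' p'') s0 ∧
      (∀ i, 1 ≤ i → i ≤ n → (K.interval p' p'').h i s0 + c' i = c'' i) ∧
      (∀ a : ℕ → ℕ, (∀ i, 1 ≤ i → i ≤ n → c' i ≤ a i ∧ a i ≤ c'' i) →
        ∀ w : (K.interval p' p'').V,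
          (IsPrin (K.interval p' p'') 0 n s0 (fun i => a i - c' i) w ↔
            IsPrin K 0 n s a w.1)) := by
  have C := hK.relCrystal
  have hs' : ∀ i, K.t i s = 0 := fun i => by
    by_contra h0
    obtain ⟨u, e⟩ := C.inn.pos_iff.1 (Nat.pos_of_ne_zero h0)
    exact hs i u e
  rw [isPrin_iff] at hp' hp''
  have := hK.1.1
  have : Finite (K.interval p' p'').V :=
    inferInstanceAs (Finite {w : K.V // dirReach K p' w ∧ dirReach K w p''})
  obtain ⟨Y, f, finj, fE, fout, finn, s0, hs0, fs0⟩ :=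
    exists_interval_embedding C hs' hc h1 h2 hp' hp''
  have D : RelCrystal n (K.interval p' p'').edge (fun i (u : (K.interval p' p'').V) => Y.h i (f u))
      (fun i u => Y.t i (f u)) :=
    Y.crystal.comap f finj (fun {i u v} => interval_edge_iff.trans fE) fout finn
  refine ⟨D.isACrystal (interval_connected K p' p''), s0, fun i u e => ?_, fun i r₁ r₂ => ?_,
    fun a ha w => ?_⟩
  · have := D.t_step (show (K.interval p' p'').edge i u s0 from e)
    rw [fs0, Y.source] at this
    omega
  · have hh : (K.interval p' p'').h i s0 = Y.h i (f s0) := congrFun (congrFun D.h_eq i) s0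
    rw [hh, fs0, Y.param i r₁ r₂]
    exact Nat.sub_add_cancel (h1 i r₁ r₂)
  · have hE : (K.interval p' p'').edge = fun i x y => K.edge i x.1 y.1 := by
      funext i x y
      exact propext interval_edge_iff
    have key := run_between_iff C hs' hc (fun i r₁ r₂ => (ha i r₁ r₂).1)
      (fun i r₁ r₂ => (ha i r₁ r₂).2.trans (h2 i r₁ r₂)) hp' s0 w hs0
    exact (isPrin_iff.trans (iff_of_eq (congrArg (fun E => Run E _ s0 w) hE))).trans
      (key.trans isPrin_iff.symm)
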